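/- Let X be a generalized cactoid. Then the union of all minimal pre-boundaries of X is itself a minimal pre-boundary of X. In particular, the boundary ∂X of X is well-defined as the unique minimal pre-boundary containing every pre-boundary. -/

import Mathlib

open Filter Topology Metric Set GromovHausdorff
open scoped ENNReal unitInterval

noncomputable section

/-! ## Model spaces -/

/-- The closed upper half plane in `ℝ × ℝ` (used for topological charts). -/
def HalfPlane : Set (ℝ × ℝ) := {p | 0 ≤ p.2}

/-- The closed upper half plane in the Euclidean plane (used for metric charts). -/
def EHalfPlane : Set (EuclideanSpace ℝ (Fin 2)) := {p | 0 ≤ p 1}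

/-- The unit circle (the 1-sphere). -/
def Circle1 : Set (EuclideanSpace ℝ (Fin 2)) := Metric.sphere 0 1

/-- The 2-sphere. -/
def Sphere2 : Set (EuclideanSpace ℝ (Fin 3)) := Metric.sphere 0 1

/-- The closed 2-disc. -/
def Disc2 : Set (EuclideanSpace ℝ (Fin 2)) := Metric.closedBall 0 1

/-- The relation on the unit square generating the Möbius identification
`(0, y) ∼ (1, 1 - y)`. -/
def mobiusRel (p q : I × I) : Prop :=
  ((p.1 : ℝ) = 0 ∧ (q.1 : ℝ) = 1 ∧ (p.2 : ℝ) = 1 - (q.2 : ℝ)) ∨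
  ((p.1 : ℝ) = 1 ∧ (q.1 : ℝ) = 0 ∧ (p.2 : ℝ) = 1 - (q.2 : ℝ))

/-- The Möbius band, as a quotient of the unit square. -/
def MobiusBand : Type := Quot mobiusRel

instance : TopologicalSpace MobiusBand :=
  inferInstanceAs (TopologicalSpace (Quot mobiusRel))

/-! ## Surfaces -/

/-- A topological 2-manifold with (possibly empty) boundary: every point has an open
neighborhood homeomorphic to an open subset of the closed half plane. -/
def IsSurface (X : Type*) [TopologicalSpace X] : Prop :=
  ∀ x : X, ∃ (U : Set X) (V : Set HalfPlane),
    IsOpen U ∧ x ∈ U ∧ IsOpen V ∧ Nonempty (↥U ≃ₜ ↥V)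

/-- A compact surface: a compact connected (Hausdorff) topological 2-manifold with
possibly empty boundary. -/
def IsCompactSurface (X : Type*) [TopologicalSpace X] : Prop :=
  CompactSpace X ∧ ConnectedSpace X ∧ T2Space X ∧ IsSurface X

/-- The (manifold) boundary of a surface: the set of points having no open neighborhood
homeomorphic to an open subset of the plane. -/
def surfaceBoundary (X : Type*) [TopologicalSpace X] : Set X :=
  {x | ¬ ∃ (U : Set X) (V : Set (ℝ × ℝ)), IsOpen U ∧ x ∈ U ∧ IsOpen V ∧ Nonempty (↥U ≃ₜ ↥V)}

/-- The set of boundary components of a surface, i.e. the connected components of the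
boundary. -/
def surfaceBoundaryComponents (X : Type*) [TopologicalSpace X] : Set (Set X) :=
  {b | ∃ x ∈ surfaceBoundary X, b = connectedComponentIn (surfaceBoundary X) x}

/-- A surface is orientable iff it contains no subset homeomorphic to the Möbius band. -/
def SurfOrientable (X : Type*) [TopologicalSpace X] : Prop :=
  ¬ ∃ A : Set X, Nonempty (↥A ≃ₜ MobiusBand)

/-- The free rank of the first homology (the abelianized fundamental group). -/
noncomputable def h1Rank (X : Type*) [TopologicalSpace X] : ℕ :=
  ⨆ x : X, (Module.rank ℤ (Additive (Abelianization (FundamentalGroup X x)))).toNat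

open Classical in
/-- The connectivity number of a compact surface `S`, i.e. `2 - χ(S)`.  By the
classification of compact surfaces this equals the free rank of the first homology,
plus one unless the surface is closed and orientable. -/
noncomputable def connNum (X : Type*) [TopologicalSpace X] : ℕ :=
  h1Rank X + (if surfaceBoundary X = ∅ ∧ SurfOrientable X then 0 else 1)

/-- The reduced connectivity number: the connectivity number minus the number of
boundary components. -/
noncomputable def redConnNum (X : Type*) [TopologicalSpace X] : ℤ :=
  (connNum X : ℤ) - ((surfaceBoundaryComponents X).ncard : ℤ)

/-! ## Length and geodesic spaces -/

/-- The length of a path, as the total variation of the parametrization. -/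
noncomputable def pathLength {X : Type*} [MetricSpace X] {x y : X} (γ : Path x y) : ℝ≥0∞ :=
  eVariationOn (fun t => γ t) Set.univ

/-- A metric space is a length space if the distance between any two points is the
infimum of the lengths of paths joining them. -/
def IsLengthSpace (X : Type*) [MetricSpace X] : Prop :=
  ∀ x y : X, edist x y = ⨅ γ : Path x y, pathLength γ

/-- A metric space is geodesic if any two points are joined by a path whose length
realizes the distance. -/
def IsGeodesicSpace (X : Type*) [MetricSpace X] : Prop :=
  ∀ x y : X, ∃ γ : Path x y, pathLength γ = edist x y

/-! ## Peano spaces, Jordan curves and cyclic elements -/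

/-- A Peano space: a compact connected locally connected metric space. -/
def IsPeano (X : Type*) [MetricSpace X] : Prop :=
  CompactSpace X ∧ ConnectedSpace X ∧ LocallyConnectedSpace X

/-- A Jordan curve: a subset homeomorphic to the 1-sphere. -/
def IsJordanCurve {X : Type*} [TopologicalSpace X] (J : Set X) : Prop :=
  Nonempty (↥J ≃ₜ ↥Circle1)

/-- A set is cyclicly connected if every pair of distinct points of it lies on a common
Jordan curve contained in it. -/
def CycliclyConnected {X : Type*} [TopologicalSpace X] (A : Set X) : Prop :=
  ∀ x ∈ A, ∀ y ∈ A, x ≠ y → ∃ J : Set X, J ⊆ A ∧ IsJordanCurve J ∧ x ∈ J ∧ y ∈ J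

/-- A maximal cyclic subset: a nondegenerate cyclicly connected subset which is not a
proper subset of any cyclicly connected subset. -/
def IsMaximalCyclic {X : Type*} [TopologicalSpace X] (A : Set X) : Prop :=
  A.Nontrivial ∧ CycliclyConnected A ∧ ∀ B : Set X, CycliclyConnected B → A ⊆ B → A = B

/-- A subcontinuum: a compact connected (hence nonempty) subset. -/
def IsSubcontinuum {X : Type*} [TopologicalSpace X] (C : Set X) : Prop :=
  IsCompact C ∧ IsConnected C

/-- `b` is a boundary component of the subset `T` (viewed as a subspace). -/
def IsBoundaryComponentOf {X : Type*} [TopologicalSpace X] (T b : Set X) : Prop :=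
  ∃ b' ∈ surfaceBoundaryComponents ↥T, b = Subtype.val '' b'

/-- An admissible subcontinuum: it meets every maximal cyclic subset `T` in at most a
point or in a boundary component of `T`. -/
def IsAdmissible {X : Type*} [TopologicalSpace X] (C : Set X) : Prop :=
  IsSubcontinuum C ∧
    ∀ T : Set X, IsMaximalCyclic T →
      ((T ∩ C).Subsingleton ∨ IsBoundaryComponentOf T (T ∩ C))

/-- A 1-cactoid: a Peano space all of whose maximal cyclic subsets are homeomorphic to
the 1-sphere. -/
def IsOneCactoid (X : Type*) [MetricSpace X] : Prop :=
  IsPeano X ∧ ∀ T : Set X, IsMaximalCyclic T → Nonempty (↥T ≃ₜ ↥Circle1)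

/-- A subset homeomorphic to the 2-sphere or the closed 2-disc. -/
def SphereOrDisc {X : Type*} [TopologicalSpace X] (T : Set X) : Prop :=
  Nonempty (↥T ≃ₜ ↥Sphere2) ∨ Nonempty (↥T ≃ₜ ↥Disc2)

/-! ## Generalized cactoids -/

/-- A generalized cactoid. -/
def IsGeneralizedCactoid (X : Type*) [MetricSpace X] : Prop :=
  IsPeano X ∧ (∀ T : Set X, IsMaximalCyclic T → IsCompactSurface ↥T) ∧
  {T : Set X | IsMaximalCyclic T ∧ ¬ SphereOrDisc T}.Finite ∧
  ∃ (n : ℕ) (C : Fin n → Set X),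
    (∀ i, IsAdmissible (C i)) ∧ (Pairwise fun i j => Disjoint (C i) (C j)) ∧
    ∀ T b : Set X, IsMaximalCyclic T → IsBoundaryComponentOf T b → b ⊆ ⋃ i, C i

/-- A pre-boundary consisting of `n` disjoint admissible subcontinua, each containing a
boundary component of some maximal cyclic subset, which together cover all boundary
components of all maximal cyclic subsets. -/
def IsPreBoundaryOfSize {X : Type*} [TopologicalSpace X] (n : ℕ) (P : Set X) : Prop :=
  ∃ C : Fin n → Set X,
    (∀ i, IsAdmissible (C i)) ∧ (Pairwise fun i j => Disjoint (C i) (C j)) ∧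
    (∀ i, ∃ T b : Set X, IsMaximalCyclic T ∧ IsBoundaryComponentOf T b ∧ b ⊆ C i) ∧
    (∀ T b : Set X, IsMaximalCyclic T → IsBoundaryComponentOf T b → b ⊆ ⋃ i, C i) ∧
    P = ⋃ i, C i

def IsPreBoundary {X : Type*} [TopologicalSpace X] (P : Set X) : Prop :=
  ∃ n, IsPreBoundaryOfSize n P

/-- A minimal pre-boundary: one with the minimal possible number of pieces. -/
def IsMinimalPreBoundary {X : Type*} [TopologicalSpace X] (P : Set X) : Prop :=
  ∃ n, IsPreBoundaryOfSize n P ∧ ∀ (m : ℕ) (Q : Set X), IsPreBoundaryOfSize m Q → n ≤ m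

/-- The boundary of a generalized cactoid: the union of all minimal pre-boundaries. -/
def cactoidBoundary (X : Type*) [TopologicalSpace X] : Set X :=
  ⋃₀ {P : Set X | IsMinimalPreBoundary P}

/-- The boundary components of a generalized cactoid: the connected components of its
boundary. -/
def cactoidBoundaryComponents (X : Type*) [TopologicalSpace X] : Set (Set X) :=
  {b | ∃ x ∈ cactoidBoundary X, b = connectedComponentIn (cactoidBoundary X) x}

/-- The connectivity number of a generalized cactoid: the sum of the reduced
connectivity numbers of its maximal cyclic subsets plus the number of its boundary
components. -/
noncomputable def cactoidConnNum (X : Type*) [TopologicalSpace X] : ℤ :=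
  (∑ᶠ T ∈ {T : Set X | IsMaximalCyclic T}, redConnNum ↥T) +
    ((cactoidBoundaryComponents X).ncard : ℤ)

/-! ## Bundled spaces -/

structure BundledMet where
  carrier : Type
  [str : MetricSpace carrier]

attribute [instance] BundledMet.str

structure BundledTop where
  carrier : Type
  [str : TopologicalSpace carrier]

attribute [instance] BundledTop.str

/-! ## Metric two-point identifications -/

/-- `p : A → B` is (the projection of) a metric 2-point identification: it glues exactly
two distinct points `x₁, x₂` of `A` and carries the corresponding quotient metric. -/
def IsTwoPointIdentification {A B : Type*} [MetricSpace A] [MetricSpace B] (p : A → B) : Prop :=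
  Function.Surjective p ∧ ∃ x₁ x₂ : A, x₁ ≠ x₂ ∧
    (∀ a b : A, p a = p b ↔ (a = b ∨ (a = x₁ ∧ b = x₂) ∨ (a = x₂ ∧ b = x₁))) ∧
    ∀ a b : A, dist (p a) (p b) =
      min (dist a b) (min (dist a x₁ + dist x₂ b) (dist a x₂ + dist x₁ b))

/-- `Y` is obtained from `X` by a successive application of `k` metric 2-point
identifications, exactly `k₀` of which are boundary identifications with respect to the
subset `B ⊆ X`. -/
def ObtainedByIdentifications (X : Type) [MetricSpace X] (B : Set X) (k k0 : ℕ)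
    (Y : Type) [MetricSpace Y] : Prop :=
  ∃ (Z : ℕ → BundledMet) (p : ∀ i : ℕ, (Z i).carrier → (Z (i + 1)).carrier)
    (e : X ≃ᵢ (Z 0).carrier) (f : (Z k).carrier ≃ᵢ Y) (q : ∀ i : ℕ, X → (Z i).carrier),
    (∀ i, i < k → IsTwoPointIdentification (p i)) ∧
    (∀ x, q 0 x = e x) ∧ (∀ i x, q (i + 1) x = p i (q i x)) ∧
    {i : ℕ | i < k ∧ ∃ a b : (Z i).carrier,
        a ∈ q i '' B ∧ b ∈ q i '' B ∧ a ≠ b ∧ p i a = p i b}.ncard = k0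

/-! ## Gromov–Hausdorff sequences of surfaces -/

/-- A sequence of (isometry classes of) compact length surfaces with connectivity
number `c`. -/
def IsSurfaceGHSeq (c : ℕ) (K : ℕ → GHSpace) : Prop :=
  ∀ n, IsCompactSurface (K n).Rep ∧ IsLengthSpace (K n).Rep ∧ connNum (K n).Rep = c

/-- The structural description of the limit spaces in the Main Theorem: `X` is obtained
from a geodesic generalized cactoid `Y` by `k` successive metric 2-point
identifications, `k₀` of them boundary identifications, where the connectivity number
of `Y` is at most `c + k₀ - 2k`. -/
def MainThmRHS (c : ℕ) (X : Type) [MetricSpace X] : Prop :=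
  ∃ (k k0 : ℕ) (Y : BundledMet),
    IsGeneralizedCactoid Y.carrier ∧ IsGeodesicSpace Y.carrier ∧
    ObtainedByIdentifications Y.carrier (cactoidBoundary Y.carrier) k k0 X ∧
    cactoidConnNum Y.carrier ≤ (c : ℤ) + (k0 : ℤ) - 2 * (k : ℤ)

/-! ## Covering dimension -/

/-- `X` has covering dimension at most `n`: every open cover admits an open refinement
of order at most `n + 1`. -/
def CoveringDimLE (X : Type*) [TopologicalSpace X] (n : ℕ) : Prop :=
  ∀ U : Set (Set X), (∀ u ∈ U, IsOpen u) → ⋃₀ U = Set.univ →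
    ∃ V : Set (Set X), (∀ v ∈ V, IsOpen v) ∧ ⋃₀ V = Set.univ ∧
      (∀ v ∈ V, ∃ u ∈ U, v ⊆ u) ∧
      ∀ x : X, {v | v ∈ V ∧ x ∈ v}.encard ≤ (n : ℕ∞) + 1

/-! ## Curves in surfaces -/

/-- A continuous map from the circle is nullhomotopic if it is homotopic to a constant. -/
def IsNullhomotopic {X : Type*} [TopologicalSpace X] (f : C(↥Circle1, X)) : Prop :=
  ∃ y : X, f.Homotopic (ContinuousMap.const _ y)

/-- A contractible Jordan curve. -/
def IsContractibleJordanCurve {X : Type*} [TopologicalSpace X] (J : Set X) : Prop :=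
  IsJordanCurve J ∧
    ∀ f : C(↥Circle1, X), Function.Injective f → Set.range f = J → IsNullhomotopic f

/-- A non-contractible Jordan curve. -/
def IsNonContractibleJordanCurve {X : Type*} [TopologicalSpace X] (J : Set X) : Prop :=
  IsJordanCurve J ∧
    ∀ f : C(↥Circle1, X), Function.Injective f → Set.range f = J → ¬ IsNullhomotopic f

/-- A simple arc in a surface: an injective path whose endpoints lie on the boundary and
whose interior does not. -/
def IsSimpleArc {X : Type*} [TopologicalSpace X] (γ : C(I, X)) : Prop :=
  Function.Injective γ ∧ γ 0 ∈ surfaceBoundary X ∧ γ 1 ∈ surfaceBoundary X ∧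
    ∀ t : I, t ≠ 0 → t ≠ 1 → γ t ∉ surfaceBoundary X

/-- A subset separates the space if its complement is disconnected. -/
def SeparatesSpace {X : Type*} [TopologicalSpace X] (A : Set X) : Prop :=
  ¬ IsPreconnected Aᶜ

/-- The arc `γ` forms a contractible Jordan curve together with a subarc of some
boundary component. -/
def FormsContractibleJordanWithBoundary {X : Type*} [TopologicalSpace X]
    (γ : C(I, X)) : Prop :=
  ∃ β : C(I, X), Function.Injective β ∧ Set.range β ⊆ surfaceBoundary X ∧
    β 0 = γ 0 ∧ β 1 = γ 1 ∧ IsContractibleJordanCurve (Set.range γ ∪ Set.range β)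

/-- `z` separates `x` and `y` inside the subset `A`: both lie in `A \ {z}` and no
connected subset of `A \ {z}` contains both. -/
def SeparatesIn {X : Type*} [TopologicalSpace X] (A : Set X) (z x y : X) : Prop :=
  x ∈ A \ {z} ∧ y ∈ A \ {z} ∧
    ∀ C : Set X, C ⊆ A \ {z} → IsPreconnected C → ¬ (x ∈ C ∧ y ∈ C)

/-! ## Metric doubles -/

/-- `D` together with the two canonical maps `ip, im : X → D` is the metric double of
`X` along the subset `B`. -/
structure IsMetricDouble (X : Type*) [MetricSpace X] (B : Set X) (D : Type*)
    [MetricSpace D] (ip im : X → D) : Prop where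
  isom_p : Isometry ip
  isom_m : Isometry im
  surj : Set.range ip ∪ Set.range im = Set.univ
  agree : ∀ z ∈ B, ip z = im z
  dist_mix : ∀ a b : X, dist (ip a) (im b) = ⨅ z : ↥B, (dist a (z : X) + dist (z : X) b)

/-- Regularity of a sequence of doubles: there is no sequence of non-contractible
Jordan curves in the doubles with vanishing diameters. -/
def RegularDoubleSeq (D : ℕ → Type) [∀ n, MetricSpace (D n)] : Prop :=
  ∀ J : ∀ n, Set (D n), (∀ n, IsNonContractibleJordanCurve (J n)) →
    0 < ⨅ n, Metric.diam (J n)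

/-- The copy `A^+` (or `A^-`) in the double limit corresponding to a subset `A` of the
limit `X`, via the isometric identification `j` of `X` with `X^+` (resp. `X^-`). -/
def plusCopy {Z D : Type*} {X : Set Z} {Xp : Set D} (j : ↥X → ↥Xp) (A : Set Z) :
    Set D :=
  (fun x => ((j x : ↥Xp) : D)) '' {x : ↥X | (x : Z) ∈ A}

/-! ## Riemannian and polyhedral surfaces -/

/-- The Riemannian length integrand `√(g_{γ(t)}(γ'(t), γ'(t)))`. -/
noncomputable def riemLengthIntegrand (g : (ℝ × ℝ) → (ℝ × ℝ) → (ℝ × ℝ) → ℝ)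
    (γ : ℝ → ℝ × ℝ) (t : ℝ) : ℝ :=
  Real.sqrt (g (γ t) (deriv γ t) (deriv γ t))

/-- A compact connected smooth Riemannian 2-manifold, as a metric space: a compact
length surface such that around every point there is a chart in which the length of
every C¹ curve is computed by a smooth positive definite symmetric bilinear metric. -/
def IsSmoothRiemannianSurface (X : Type*) [MetricSpace X] : Prop :=
  IsCompactSurface X ∧ IsLengthSpace X ∧
  ∀ x : X, ∃ (U : Set X) (V : Set (ℝ × ℝ)) (φ : X → ℝ × ℝ) (ψ : ℝ × ℝ → X)
      (g : (ℝ × ℝ) → (ℝ × ℝ) → (ℝ × ℝ) → ℝ),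
    IsOpen U ∧ x ∈ U ∧ (∃ V' : Set (ℝ × ℝ), IsOpen V' ∧ V = V' ∩ HalfPlane) ∧
    ContinuousOn φ U ∧ φ '' U = V ∧ ContinuousOn ψ V ∧
    (∀ y ∈ U, ψ (φ y) = y) ∧ (∀ v ∈ V, φ (ψ v) = v) ∧
    (∀ m : ℕ, ContDiffOn ℝ m
      (fun pq : (ℝ × ℝ) × (ℝ × ℝ) × (ℝ × ℝ) => g pq.1 pq.2.1 pq.2.2)
      (V ×ˢ ((Set.univ : Set (ℝ × ℝ)) ×ˢ (Set.univ : Set (ℝ × ℝ))))) ∧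
    (∀ p u v, g p u v = g p v u) ∧
    (∀ p (a : ℝ) u u' v, g p (a • u + u') v = a * g p u v + g p u' v) ∧
    (∀ p ∈ V, ∀ u : ℝ × ℝ, u ≠ 0 → 0 < g p u u) ∧
    ∀ (cur : ℝ → X) (a b : ℝ), a ≤ b → Set.MapsTo cur (Set.Icc a b) U →
      ContDiffOn ℝ 1 (φ ∘ cur) (Set.Icc a b) →
      eVariationOn cur (Set.Icc a b) =
        ENNReal.ofReal (∫ t in a..b, riemLengthIntegrand g (φ ∘ cur) t)

/-- A polyhedral surface: a compact length surface which is flat (locally isometric to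
a subset of the Euclidean half plane) away from finitely many singular points. -/
def IsPolyhedralSurface (X : Type*) [MetricSpace X] : Prop :=
  IsCompactSurface X ∧ IsLengthSpace X ∧
  ∃ F : Set X, F.Finite ∧ ∀ x : X, x ∉ F →
    ∃ (U : Set X) (W : Set (EuclideanSpace ℝ (Fin 2))),
      IsOpen U ∧ x ∈ U ∧ W ⊆ EHalfPlane ∧ Nonempty (↥U ≃ᵢ ↥W)

end

/-! ## Local path connectedness of complete locally connected spaces -/

/-- `f` maps `[s, t]` along a finite chain of connected open sets of diameter at most `ε`. -/
inductive StepPath {X : Type*} [MetricSpace X] (ε : ℝ) : (ℝ → X) → ℝ → ℝ → Prop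
  | step {f : ℝ → X} {s t : ℝ} (hst : s < t) (U : Set X) (hU : IsOpen U)
      (hc : IsPreconnected U) (hd : ∀ x ∈ U, ∀ y ∈ U, dist x y < ε)
      (hf : ∀ u ∈ Icc s t, f u ∈ U) : StepPath ε f s t
  | glue {f g h : ℝ → X} {s m t : ℝ} (hf : StepPath ε f s m) (hg : StepPath ε g m t)
      (hfh : EqOn f h (Icc s m)) (hgh : EqOn g h (Icc m t)) : StepPath ε h s t

namespace StepPath

variable {X : Type*} [MetricSpace X] {ε δ : ℝ} {f g : ℝ → X} {s m t : ℝ}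

lemma lt (h : StepPath ε f s t) : s < t := by
  induction h with
  | step hst => exact hst
  | glue _ _ _ _ h₁ h₂ => exact h₁.trans h₂

lemma glue_ite (hf : StepPath ε f s m) (hg : StepPath ε g m t) (hm : f m = g m) :
    StepPath ε (fun u => if u ≤ m then f u else g u) s t := by
  refine hf.glue hg (fun u hu => by simp [hu.2]) fun u hu => ?_
  rcases hu.1.eq_or_lt with rfl | h
  · simp [hm]
  · simp [h.not_ge]

lemma exists_of_isPreconnected [LocallyConnectedSpace X] (hε : 0 < ε) {U : Set X}
    (hU : IsOpen U) (hc : IsPreconnected U) {x y : X} (hx : x ∈ U) (hy : y ∈ U) :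
    ∀ s t : ℝ, s < t → ∃ g : ℝ → X, g s = x ∧ g t = y ∧ (∀ u ∈ Icc s t, g u ∈ U) ∧
      StepPath ε g s t := by
  refine hc.induction₂' (fun x y => ∀ s t : ℝ, s < t → ∃ g : ℝ → X, g s = x ∧ g t = y ∧
    (∀ u ∈ Icc s t, g u ∈ U) ∧ StepPath ε g s t) ?_ ?_ hx hy
  · intro x hx
    obtain ⟨V, hVs, hVo, hxV, hVc⟩ := locallyConnectedSpace_iff_subsets_isOpen_isConnected.1
      inferInstance x (U ∩ ball x (ε / 2)) (inter_mem (hU.mem_nhds hx) (ball_mem_nhds x (by simpa)))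
    have key : ∀ a ∈ V, ∀ b ∈ V, ∀ s t : ℝ, s < t → ∃ g : ℝ → X, g s = a ∧ g t = b ∧
        (∀ u ∈ Icc s t, g u ∈ U) ∧ StepPath ε g s t := by
      intro a ha b hb s t hst
      have hmem : ∀ u, (if u < t then a else b) ∈ V := fun u => by split_ifs <;> assumption
      refine ⟨fun u => if u < t then a else b, by simp [hst], by simp,
        fun u _ => (hVs (hmem u)).1, .step hst V hVo hVc.isPreconnected (fun p hp q hq => ?_)
        fun u _ => hmem u⟩
      have h₁ := (hVs hp).2
      have h₂ := (hVs hq).2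
      rw [mem_ball] at h₁ h₂
      linarith [dist_triangle_right p q x]
    filter_upwards [mem_nhdsWithin_of_mem_nhds (hVo.mem_nhds hxV)] with y hy
    exact ⟨key x hxV y hy, key y hy x hxV⟩
  · intro x y z _ _ _ hxy hyz s t hst
    obtain ⟨g, hg1, hg2, hgU, hg⟩ := hxy s ((s + t) / 2) (by linarith)
    obtain ⟨h, hh1, hh2, hhU, hh⟩ := hyz ((s + t) / 2) t (by linarith)
    refine ⟨_, ?_, ?_, fun u hu => ?_, hg.glue_ite hh (hg2.trans hh1.symm)⟩
    · simp [show s ≤ (s + t) / 2 by linarith, hg1]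
    · simp [show ¬ t ≤ (s + t) / 2 by linarith, hh2]
    · split_ifs with hu'
      · exact hgU u ⟨hu.1, hu'⟩
      · exact hhU u ⟨(not_le.1 hu').le, hu.2⟩

lemma refine_step [LocallyConnectedSpace X] (hδ : 0 < δ) (hf : StepPath ε f s t) :
    ∃ g : ℝ → X, g s = f s ∧ g t = f t ∧ (∀ u ∈ Icc s t, dist (f u) (g u) < ε) ∧
      StepPath δ g s t := by
  induction hf with
  | @step f s t hst U hU hc hd hf =>
    obtain ⟨g, h1, h2, h3, h4⟩ := exists_of_isPreconnected hδ hU hc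
      (hf s ⟨le_rfl, hst.le⟩) (hf t ⟨hst.le, le_rfl⟩) s t hst
    exact ⟨g, h1, h2, fun u hu => hd _ (hf u hu) _ (h3 u hu), h4⟩
  | @glue f g h s m t hf hg hfh hgh ihf ihg =>
    obtain ⟨f', f1, f2, f3, f4⟩ := ihf
    obtain ⟨g', g1, g2, g3, g4⟩ := ihg
    have hsm := hf.lt
    have hmt := hg.lt
    have e1 : f s = h s := hfh ⟨le_rfl, hsm.le⟩
    have e2 : f m = h m := hfh ⟨hsm.le, le_rfl⟩
    have e3 : g m = h m := hgh ⟨le_rfl, hmt.le⟩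
    have e4 : g t = h t := hgh ⟨hmt.le, le_rfl⟩
    refine ⟨_, ?_, ?_, fun u hu => ?_, f4.glue_ite g4 (by rw [f2, g1, e2, e3])⟩
    · simp [hsm.le, f1, e1]
    · simp [hmt.not_ge, g2, e4]
    · split_ifs with hu'
      · rw [← hfh ⟨hu.1, hu'⟩]
        exact f3 u ⟨hu.1, hu'⟩
      · rw [← hgh ⟨(not_le.1 hu').le, hu.2⟩]
        exact g3 u ⟨(not_le.1 hu').le, hu.2⟩

lemma eventually_dist_lt (hf : StepPath ε f s t) :
    ∀ u ∈ Icc s t, ∀ᶠ v in 𝓝 u, v ∈ Icc s t → dist (f v) (f u) < ε := by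
  induction hf with
  | step hst U hU hc hd hf =>
    exact fun u hu => Eventually.of_forall fun v hv => hd _ (hf v hv) _ (hf u hu)
  | @glue f g h s m t hf hg hfh hgh ihf ihg =>
    intro u hu
    have h1 : ∀ᶠ v in 𝓝 u, v ∈ Icc s m → dist (h v) (h u) < ε := by
      by_cases hum : u ≤ m
      · filter_upwards [ihf u ⟨hu.1, hum⟩] with v hv hv'
        rw [← hfh hv', ← hfh ⟨hu.1, hum⟩]
        exact hv hv'
      · filter_upwards [lt_mem_nhds (not_le.1 hum)] with v hv hv'
        exact absurd hv'.2 hv.not_ge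
    have h2 : ∀ᶠ v in 𝓝 u, v ∈ Icc m t → dist (h v) (h u) < ε := by
      by_cases hum : m ≤ u
      · filter_upwards [ihg u ⟨hum, hu.2⟩] with v hv hv'
        rw [← hgh hv', ← hgh ⟨hum, hu.2⟩]
        exact hv hv'
      · filter_upwards [gt_mem_nhds (not_le.1 hum)] with v hv hv'
        exact absurd hv'.1 hv.not_ge
    filter_upwards [h1, h2] with v hv1 hv2 hv
    rcases le_total v m with h | h
    · exact hv1 ⟨hv.1, h⟩
    · exact hv2 ⟨h, hv.2⟩

end StepPath

lemma joinedIn_ball_of_isPreconnected {X : Type*} [MetricSpace X] [CompleteSpace X]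
    [LocallyConnectedSpace X] {ε : ℝ} (hε : 0 < ε) {U : Set X} (hU : IsOpen U)
    (hc : IsPreconnected U) (hd : ∀ x ∈ U, ∀ y ∈ U, dist x y < ε) {x y : X} (hx : x ∈ U)
    (hy : y ∈ U) : JoinedIn (ball x (4 * ε)) x y := by
  have hε' : ∀ n : ℕ, 0 < ε / 2 ^ n := fun n => by positivity
  let S : ℕ → Type _ := fun n => {f : ℝ → X // StepPath (ε / 2 ^ n) f 0 1 ∧ f 0 = x ∧ f 1 = y}
  have hmem : ∀ u : ℝ, (if u < 1 then x else y) ∈ U := fun u => by split_ifs <;> assumption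
  let f₀ : S 0 := ⟨fun u => if u < 1 then x else y,
    .step one_pos U hU hc (by simpa using hd) fun u _ => hmem u, by simp, by simp⟩
  have next : ∀ n, ∀ f : S n, ∃ g : S (n + 1),
      ∀ u ∈ Icc (0 : ℝ) 1, dist (f.1 u) (g.1 u) < ε / 2 ^ n := by
    rintro n ⟨f, hf, h0, h1⟩
    obtain ⟨g, g0, g1, gd, hg⟩ := hf.refine_step (hε' (n + 1))
    exact ⟨⟨g, hg, g0.trans h0, g1.trans h1⟩, gd⟩
  choose nx hnx using next
  let F : ∀ n, S n := fun n => Nat.rec f₀ (fun n f => nx n f) n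
  have hF : ∀ n, ∀ u ∈ Icc (0 : ℝ) 1, dist ((F n).1 u) ((F (n + 1)).1 u) ≤ 2 * ε / 2 / 2 ^ n :=
    fun n u hu => by simpa using (hnx n (F n) u hu).le
  have hlim : ∀ u : ℝ, ∃ z, u ∈ Icc (0 : ℝ) 1 → Tendsto (fun n => (F n).1 u) atTop (𝓝 z) := by
    intro u
    by_cases hu : u ∈ Icc (0 : ℝ) 1
    · obtain ⟨z, hz⟩ := cauchySeq_tendsto_of_complete
        (cauchySeq_of_le_geometric_two fun n => hF n u hu)
      exact ⟨z, fun _ => hz⟩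
    · exact ⟨x, fun h => absurd h hu⟩
  choose f hf using hlim
  have hdist : ∀ n, ∀ u ∈ Icc (0 : ℝ) 1, dist ((F n).1 u) (f u) ≤ 2 * ε / 2 ^ n :=
    fun n u hu => dist_le_of_le_geometric_two_of_tendsto (fun n => hF n u hu) (hf u hu) n
  have h0 : (0 : ℝ) ∈ Icc (0 : ℝ) 1 := by simp
  have h1 : (1 : ℝ) ∈ Icc (0 : ℝ) 1 := by simp
  refine JoinedIn.ofLine (f := f) ?_ ?_ ?_ ?_
  · intro u hu
    rw [Metric.continuousWithinAt_iff']
    intro η hη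
    obtain ⟨n, hn⟩ : ∃ n : ℕ, 5 * ε / 2 ^ n < η := by
      obtain ⟨n, hn⟩ := exists_pow_lt_of_lt_one (show 0 < η / (5 * ε) by positivity)
        (show (1 / 2 : ℝ) < 1 by norm_num)
      refine ⟨n, ?_⟩
      rw [lt_div_iff₀ (by positivity)] at hn
      calc 5 * ε / 2 ^ n = (1 / 2) ^ n * (5 * ε) := by rw [one_div, inv_pow]; ring
        _ < η := hn
    rw [eventually_nhdsWithin_iff]
    filter_upwards [(F n).2.1.eventually_dist_lt u hu] with v hv hv'
    have e1 := hv hv'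
    have e2 := hdist n u hu
    have e3 := hdist n v hv'
    have e4 : 5 * ε / 2 ^ n = 2 * ε / 2 ^ n + ε / 2 ^ n + 2 * ε / 2 ^ n := by ring
    have e5 := dist_triangle4 (f v) ((F n).1 v) ((F n).1 u) (f u)
    rw [dist_comm (f v) ((F n).1 v)] at e5
    linarith
  · exact tendsto_nhds_unique (hf 0 h0) (by simp [(F _).2.2.1])
  · exact tendsto_nhds_unique (hf 1 h1) (by simp [(F _).2.2.2])
  · rintro _ ⟨u, hu, rfl⟩
    have e1 := hdist 0 u hu
    have e2 : dist ((F 0).1 u) x < ε := hd _ (hmem u) _ hx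
    rw [mem_ball]
    have e3 := dist_triangle (f u) ((F 0).1 u) x
    rw [dist_comm (f u) ((F 0).1 u)] at e3
    norm_num at e1
    linarith

/-- A complete locally connected metric space is locally path connected. -/
lemma locallyPathConnectedSpace_of_complete {X : Type*} [MetricSpace X] [CompleteSpace X]
    [LocallyConnectedSpace X] : LocallyPathConnectedSpace X := by
  rw [locallyPathConnectedSpace_iff_pathComponentIn_mem_nhds]
  intro x u hu hxu
  obtain ⟨r, hr, hru⟩ := Metric.isOpen_iff.1 hu x hxu
  obtain ⟨V, hVs, hVo, hxV, hVc⟩ := locallyConnectedSpace_iff_subsets_isOpen_isConnected.1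
    inferInstance x (ball x (r / 8)) (ball_mem_nhds x (by linarith))
  refine mem_of_superset (hVo.mem_nhds hxV) fun y hy => ?_
  refine (joinedIn_ball_of_isPreconnected (ε := r / 4) (by linarith) hVo hVc.isPreconnected
    (fun p hp q hq => ?_) hxV hy).mono ?_
  · have h₁ := hVs hp
    have h₂ := hVs hq
    rw [mem_ball] at h₁ h₂
    linarith [dist_triangle_right p q x]
  · exact (ball_subset_ball (by linarith)).trans hru

/-! ## Arcs -/

/-- `A` is an arc with endpoints `a` and `b`. -/
def IsArc {X : Type*} [TopologicalSpace X] (A : Set X) (a b : X) : Prop :=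
  ∃ f : ℝ → X, ContinuousOn f (Icc 0 1) ∧ InjOn f (Icc 0 1) ∧ f 0 = a ∧ f 1 = b ∧
    f '' Icc 0 1 = A

/-- A closed subset of `[0, 1]` containing the endpoints, such that `γ` agrees on the two
endpoints of every gap. -/
def IsCut {X : Type*} (γ : ℝ → X) (F : Set ℝ) : Prop :=
  IsClosed F ∧ 0 ∈ F ∧ 1 ∈ F ∧ F ⊆ Icc 0 1 ∧
    ∀ a ∈ F, ∀ b ∈ F, a < b → Disjoint (Ioo a b) F → γ a = γ b

lemma exists_minimal_isCut {X : Type*} [MetricSpace X] {γ : ℝ → X} (hγ : Continuous γ) :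
    ∃ F, Minimal (IsCut γ) F := by
  have hI : IsCut γ (Icc 0 1) := by
    refine ⟨isClosed_Icc, by simp, by simp, subset_rfl, fun a ha b hb hab hd => ?_⟩
    exact absurd (show (a + b) / 2 ∈ Icc (0 : ℝ) 1 from ⟨by linarith [ha.1], by linarith [hb.2]⟩)
      (Set.disjoint_left.1 hd ⟨by linarith, by linarith⟩)
  refine (zorn_superset_nonempty {F | IsCut γ F} (fun c hcS hc hne => ?_) _ hI).imp
    fun F h => h.2
  refine ⟨⋂₀ c, ⟨isClosed_sInter fun F hF => (hcS hF).1, fun F hF => (hcS hF).2.1,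
    fun F hF => (hcS hF).2.2.1, ?_, ?_⟩, fun F hF => sInter_subset_of_mem hF⟩
  · obtain ⟨F, hF⟩ := hne
    exact (sInter_subset_of_mem hF).trans (hcS hF).2.2.2.1
  intro a ha b hb hab hd
  by_contra hne'
  have hη : 0 < dist (γ a) (γ b) / 2 := half_pos (dist_pos.2 hne')
  obtain ⟨δ₁, hδ₁, h₁⟩ := Metric.continuous_iff.1 hγ a _ hη
  obtain ⟨δ₂, hδ₂, h₂⟩ := Metric.continuous_iff.1 hγ b _ hη
  obtain ⟨δ, hδ, hδa, hδb, hδab⟩ : ∃ δ, 0 < δ ∧ δ < δ₁ ∧ δ < δ₂ ∧ δ < (b - a) / 2 := by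
    refine ⟨min δ₁ (min δ₂ ((b - a) / 2)) / 2, ?_, ?_⟩
    · have : 0 < (b - a) / 2 := by linarith
      positivity
    · have e : 0 < min δ₁ (min δ₂ ((b - a) / 2)) := by
        have : 0 < (b - a) / 2 := by linarith
        positivity
      have e1 := min_le_left δ₁ (min δ₂ ((b - a) / 2))
      have e2 := (min_le_right δ₁ (min δ₂ ((b - a) / 2))).trans (min_le_left _ _)
      have e3 := (min_le_right δ₁ (min δ₂ ((b - a) / 2))).trans (min_le_right _ _)
      exact ⟨by linarith, by linarith, by linarith⟩
  have : Nonempty c := hne.to_subtype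
  obtain ⟨⟨F, hF⟩, hFd⟩ := (isCompact_Icc (a := a + δ) (b := b - δ)).elim_directed_family_closed
    (fun F : c => (F : Set ℝ)) (fun F => (hcS F.2).1) (by
      rw [← sInter_eq_iInter, ← disjoint_iff_inter_eq_empty]
      exact hd.mono_left (show Icc (a + δ) (b - δ) ⊆ Ioo a b from
        fun u hu => ⟨by linarith [hu.1], by linarith [hu.2]⟩))
    (by
      rintro ⟨F, hF⟩ ⟨G, hG⟩
      rcases hc.total hF hG with h | h
      · exact ⟨⟨F, hF⟩, subset_rfl, h⟩
      · exact ⟨⟨G, hG⟩, h, subset_rfl⟩)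
  have hFc := (hcS hF).1
  have hFa : a ∈ F := ha F hF
  have hFb : b ∈ F := hb F hF
  obtain ⟨p, ⟨hpF, hpa⟩, hp⟩ := (isCompact_Icc.inter_left hFc).exists_isGreatest
    (s := F ∩ Icc a (a + δ)) ⟨a, hFa, by simp [hδ.le]⟩
  obtain ⟨q, ⟨hqF, hqb⟩, hq⟩ := (isCompact_Icc.inter_left hFc).exists_isLeast
    (s := F ∩ Icc (b - δ) b) ⟨b, hFb, by simp [hδ.le]⟩
  have hpq : γ p = γ q := by
    refine (hcS hF).2.2.2.2 p hpF q hqF (by linarith [hpa.2, hqb.1]) ?_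
    rw [Set.disjoint_left]
    intro u hu huF
    rcases le_or_gt u (a + δ) with h | h
    · exact hu.1.not_ge (hp ⟨huF, by linarith [hpa.1, hu.1], h⟩)
    rcases le_or_gt (b - δ) u with h' | h'
    · exact hu.2.not_ge (hq ⟨huF, h', by linarith [hqb.2, hu.2]⟩)
    · exact (hFd ▸ (⟨⟨h.le, h'.le⟩, huF⟩ : u ∈ Icc (a + δ) (b - δ) ∩ F) : u ∈ (∅ : Set ℝ))
  have e1 := h₁ p (by rw [Real.dist_eq, abs_of_nonneg] <;> linarith [hpa.1, hpa.2])
  have e2 := h₂ q (by rw [Real.dist_eq, abs_of_nonpos] <;> linarith [hqb.1, hqb.2])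
  rw [hpq] at e1
  linarith [dist_triangle_left (γ a) (γ b) (γ q)]

lemma eq_of_minimal_isCut {X : Type*} {γ : ℝ → X} {F : Set ℝ} (hF : Minimal (IsCut γ) F)
    {s t : ℝ} (hs : s ∈ F) (ht : t ∈ F) (h : γ s = γ t) :
    Disjoint (Ioo s t) F := by
  have hcut := hF.prop
  have hsI := hcut.2.2.2.1 hs
  have htI := hcut.2.2.2.1 ht
  have hF' : IsCut γ (F \ Ioo s t) := by
    refine ⟨hcut.1.sdiff isOpen_Ioo, ⟨hcut.2.1, fun h => h.1.not_ge hsI.1⟩,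
      ⟨hcut.2.2.1, fun h => h.2.not_ge htI.2⟩, sdiff_subset.trans hcut.2.2.2.1, ?_⟩
    intro a ha b hb hab hd
    have hsd : s ∈ F \ Ioo s t := ⟨hs, by simp⟩
    have htd : t ∈ F \ Ioo s t := ⟨ht, by simp⟩
    by_cases hdF : Disjoint (Ioo a b) F
    · exact hcut.2.2.2.2 a ha.1 b hb.1 hab hdF
    · obtain ⟨u, hu, huF⟩ := not_disjoint_iff.1 hdF
      have hus : u ∈ Ioo s t := by
        by_contra hus
        exact Set.disjoint_left.1 hd hu ⟨huF, hus⟩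
      have has : a ≤ s := by
        by_contra! h
        exact ha.2 ⟨h, hu.1.trans hus.2⟩
      have hbt : t ≤ b := by
        by_contra! h
        exact hb.2 ⟨hus.1.trans hu.2, h⟩
      have has' : a = s := by
        by_contra hne
        exact Set.disjoint_left.1 hd ⟨lt_of_le_of_ne has hne, hus.1.trans hu.2⟩ hsd
      have hbt' : t = b := by
        by_contra hne
        exact Set.disjoint_left.1 hd ⟨hu.1.trans hus.2, lt_of_le_of_ne hbt hne⟩ htd
      rw [has', ← hbt', h]
  have := hF.le_of_le hF' sdiff_subset
  rw [Set.disjoint_left]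
  exact fun u hu huF => (this huF).2 hu

/-- Every path can be made monotone, i.e. such that fibres are intervals. -/
lemma exists_monotone_path {X : Type*} [MetricSpace X] {γ : ℝ → X} (hγ : Continuous γ) :
    ∃ g : ℝ → X, Continuous g ∧ g 0 = γ 0 ∧ g 1 = γ 1 ∧ g '' Icc 0 1 ⊆ γ '' Icc 0 1 ∧
      ∀ s ∈ Icc (0 : ℝ) 1, ∀ t ∈ Icc (0 : ℝ) 1, s ≤ t → g s = g t →
        ∀ u ∈ Icc s t, g u = g s := by
  obtain ⟨F, hF⟩ := exists_minimal_isCut hγ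
  obtain ⟨hFc, h0, h1, hFI, hgap⟩ := hF.prop
  have hL : ∀ t, ∃ l, t ∈ Icc (0 : ℝ) 1 → IsGreatest (F ∩ Icc 0 t) l := by
    intro t
    by_cases ht : t ∈ Icc (0 : ℝ) 1
    · exact ((isCompact_Icc.inter_left hFc).exists_isGreatest ⟨0, h0, by simp [ht.1]⟩).imp
        fun _ h _ => h
    · exact ⟨0, fun h => absurd h ht⟩
  choose L hL using hL
  have hL0 : L 0 = 0 := by
    have := (hL 0 (by simp)).1.2
    exact le_antisymm this.2 this.1
  have hLF : ∀ t ∈ F, L t = t := fun t ht =>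
    le_antisymm (hL t (hFI ht)).1.2.2 ((hL t (hFI ht)).2 ⟨ht, (hFI ht).1, le_rfl⟩)
  have hmono : ∀ s ∈ Icc (0 : ℝ) 1, ∀ t ∈ Icc (0 : ℝ) 1, s ≤ t → L s ≤ L t :=
    fun s hs t ht hst => (hL t ht).2 ⟨(hL s hs).1.1, (hL s hs).1.2.1, (hL s hs).1.2.2.trans hst⟩
  have hclose : ∀ s ∈ Icc (0 : ℝ) 1, ∀ t ∈ Icc (0 : ℝ) 1, s ≤ t →
      ∃ p ∈ Icc s t, ∃ q ∈ Icc s t, dist (γ (L s)) (γ (L t)) ≤ dist (γ p) (γ q) := by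
    intro s hs t ht hst
    obtain ⟨⟨hLs, hLs0, hLss⟩, hLs'⟩ := hL s hs
    obtain ⟨⟨hLt, hLt0, hLtt⟩, hLt'⟩ := hL t ht
    obtain ⟨r, ⟨hrF, hr⟩, hr'⟩ := (isCompact_Icc.inter_left hFc).exists_isLeast
      (s := F ∩ Icc s 1) ⟨1, h1, by simp [hs.2]⟩
    by_cases hrt : r ≤ t
    · refine ⟨r, ⟨hr.1, hrt⟩, L t, ⟨?_, hLtt⟩, ?_⟩
      · exact hr.1.trans (hLt' ⟨hrF, (hFI hrF).1, hrt⟩)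
      · have hγr : γ (L s) = γ r := by
          rcases (hLss.trans hr.1).eq_or_lt with h | h
          · rw [h]
          · refine hgap _ hLs r hrF h (Set.disjoint_left.2 fun u hu huF => ?_)
            rcases le_total u s with hus | hus
            · exact hu.1.not_ge (hLs' ⟨huF, (hFI huF).1, hus⟩)
            · exact hu.2.not_ge (hr' ⟨huF, hus, (hFI huF).2⟩)
        rw [hγr]
    · have hLts : L t ≤ s := by
        by_contra! h
        exact hrt ((hr' ⟨hLt, h.le, (hFI hLt).2⟩).trans hLtt)
      have heq : L t = L s := le_antisymm (hLs' ⟨hLt, hLt0, hLts⟩) (hmono s hs t ht hst)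
      exact ⟨s, ⟨le_rfl, hst⟩, s, ⟨le_rfl, hst⟩, by simp [heq]⟩
  have hcont : ContinuousOn (fun t => γ (L t)) (Icc 0 1) := by
    have huc := isCompact_Icc.uniformContinuousOn_of_continuous
      (hγ.continuousOn (s := Icc (0 : ℝ) 1))
    rw [Metric.uniformContinuousOn_iff] at huc
    refine UniformContinuousOn.continuousOn (Metric.uniformContinuousOn_iff.2 fun ε hε => ?_)
    obtain ⟨δ, hδ, h⟩ := huc ε hε
    have key : ∀ s ∈ Icc (0 : ℝ) 1, ∀ t ∈ Icc (0 : ℝ) 1, dist s t < δ → s ≤ t →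
        dist (γ (L s)) (γ (L t)) < ε := by
      intro s hs t ht hd hst
      obtain ⟨p, hp, q, hq, hpq⟩ := hclose s hs t ht hst
      refine hpq.trans_lt (h p ⟨hs.1.trans hp.1, hp.2.trans ht.2⟩ q
        ⟨hs.1.trans hq.1, hq.2.trans ht.2⟩ (lt_of_le_of_lt ?_ hd))
      rw [dist_comm s t, Real.dist_eq t s, abs_of_nonneg (by linarith)]
      exact Real.dist_le_of_mem_Icc hp hq
    refine ⟨δ, hδ, fun s hs t ht hd => ?_⟩
    rcases le_total s t with hst | hst
    · exact key s hs t ht hd hst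
    · rw [dist_comm]
      exact key t ht s hs (by rwa [dist_comm]) hst
  have hext : ∀ t ∈ Icc (0 : ℝ) 1,
      IccExtend zero_le_one ((Icc (0 : ℝ) 1).domRestrict fun t => γ (L t)) t = γ (L t) :=
    fun t ht => by rw [IccExtend_of_mem _ _ ht, domRestrict_apply]
  refine ⟨IccExtend zero_le_one ((Icc (0 : ℝ) 1).domRestrict fun t => γ (L t)),
    hcont.domRestrict.Icc_extend', ?_, ?_, ?_, ?_⟩
  · rw [hext 0 (by simp), hL0]
  · rw [hext 1 (by simp), hLF 1 h1]
  · rintro _ ⟨t, ht, rfl⟩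
    rw [hext t ht]
    exact mem_image_of_mem _ (hFI (hL t ht).1.1)
  · intro s hs t ht hst h u hu
    have hu' : u ∈ Icc (0 : ℝ) 1 := ⟨hs.1.trans hu.1, hu.2.trans ht.2⟩
    rw [hext s hs, hext t ht] at h
    rw [hext s hs, hext u hu']
    have hsu := hmono s hs u hu' hu.1
    have hut := hmono u hu' t ht hu.2
    rcases hsu.eq_or_lt with h1 | h1
    · rw [h1]
    rcases hut.eq_or_lt with h2 | h2
    · rw [h2, h]
    · exact absurd (hL u hu').1.1 (Set.disjoint_left.1
        (eq_of_minimal_isCut hF (hL s hs).1.1 (hL t ht).1.1 h) ⟨h1, h2⟩)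

/-- A continuous real function on `[0, 1]` distinguishing exactly the fibres of a monotone path. -/
lemma exists_height {X : Type*} [MetricSpace X] [CompactSpace X] {g : ℝ → X}
    (hg : Continuous g) (hmono : ∀ s ∈ Icc (0 : ℝ) 1, ∀ t ∈ Icc (0 : ℝ) 1, s ≤ t → g s = g t →
        ∀ u ∈ Icc s t, g u = g s) :
    ∃ φ : ℝ → ℝ, Continuous φ ∧ AntitoneOn φ (Icc 0 1) ∧
      ∀ s ∈ Icc (0 : ℝ) 1, ∀ t ∈ Icc (0 : ℝ) 1, (φ s = φ t ↔ g s = g t) := by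
  have : Nonempty X := ⟨g 0⟩
  let x := TopologicalSpace.denseSeq X
  let H : ℕ → ℝ → ℝ := fun k t => sInf ((fun r => dist (x k) (g (t * r))) '' Icc 0 1)
  have hHcont : ∀ k, Continuous (H k) := fun k => isCompact_Icc.continuous_sInf (by
    change Continuous fun p : ℝ × ℝ => dist (x k) (g (p.1 * p.2))
    fun_prop)
  have hbdd : ∀ k (t : ℝ) , BddBelow ((fun r => dist (x k) (g (t * r))) '' Icc 0 1) :=
    fun k t => ⟨0, by rintro _ ⟨r, _, rfl⟩; exact dist_nonneg⟩
  have hH : ∀ k, ∀ t, ∀ r ∈ Icc (0 : ℝ) 1, H k t ≤ dist (x k) (g (t * r)) :=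
    fun k t r hr => csInf_le (hbdd k t) ⟨r, hr, rfl⟩
  have hH' : ∀ k, ∀ t ∈ Icc (0 : ℝ) 1, ∀ u ∈ Icc (0 : ℝ) t, H k t ≤ dist (x k) (g u) := by
    intro k t ht u hu
    rcases ht.1.eq_or_lt with rfl | h
    · have : u = 0 := le_antisymm hu.2 hu.1
      simpa [this] using hH k 0 0 (by simp)
    · have := hH k t (u / t) ⟨by have := hu.1; positivity, (div_le_one h).2 hu.2⟩
      rwa [mul_div_cancel₀ _ h.ne'] at this
  have hHle : ∀ k t c, 0 ≤ t → (∀ u ∈ Icc (0 : ℝ) t, c ≤ dist (x k) (g u)) → c ≤ H k t := by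
    intro k t c ht h
    refine le_csInf ⟨_, 0, by simp, rfl⟩ ?_
    rintro _ ⟨r, hr, rfl⟩
    exact h _ ⟨mul_nonneg ht hr.1, mul_le_of_le_one_right ht hr.2⟩
  have hanti : ∀ k, AntitoneOn (H k) (Icc 0 1) := fun k s hs t ht hst =>
    hHle k s _ hs.1 fun u hu => hH' k t ht u ⟨hu.1, hu.2.trans hst⟩
  obtain ⟨D, hD⟩ := Metric.isBounded_iff.1 (isCompact_univ (X := X)).isBounded
  have hnn : ∀ k t, 0 ≤ H k t := fun k t => Real.sInf_nonneg (by
    rintro _ ⟨r, _, rfl⟩; exact dist_nonneg)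
  have hle : ∀ k t, H k t ≤ D := fun k t =>
    (hH k t 0 (by simp)).trans (hD (mem_univ _) (mem_univ _))
  have hsum : Summable fun k : ℕ => D * (1 / 2 : ℝ) ^ k :=
    (summable_geometric_of_lt_one (by norm_num) (by norm_num)).mul_left D
  have hnorm : ∀ k t, ‖H k t * (1 / 2 : ℝ) ^ k‖ ≤ D * (1 / 2 : ℝ) ^ k := fun k t => by
    rw [Real.norm_of_nonneg (mul_nonneg (hnn k t) (by positivity))]
    exact mul_le_mul_of_nonneg_right (hle k t) (by positivity)
  have hs : ∀ t, Summable fun k => H k t * (1 / 2 : ℝ) ^ k := fun t =>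
    hsum.of_norm_bounded fun k => hnorm k t
  have hstrict : ∀ s ∈ Icc (0 : ℝ) 1, ∀ t ∈ Icc (0 : ℝ) 1, s ≤ t → g s ≠ g t →
      ∑' k, H k t * (1 / 2 : ℝ) ^ k < ∑' k, H k s * (1 / 2 : ℝ) ^ k := by
    intro s hs' t ht hst hne
    have hnot : g t ∉ g '' Icc 0 s := by
      rintro ⟨u, hu, hut⟩
      have hu1 : u ∈ Icc (0 : ℝ) 1 := ⟨hu.1, hu.2.trans hs'.2⟩
      exact hne ((hmono u hu1 t ht (hu.2.trans hst) hut s ⟨hu.2, hst⟩).trans hut)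
    have hcl : IsClosed (g '' Icc 0 s) := (isCompact_Icc.image hg).isClosed
    have hpos : 0 < infDist (g t) (g '' Icc 0 s) :=
      (hcl.notMem_iff_infDist_pos ⟨_, 0, by simp [hs'.1], rfl⟩).1 hnot
    obtain ⟨k, hk⟩ := (TopologicalSpace.denseRange_denseSeq X).exists_dist_lt (g t) (half_pos hpos)
    refine Summable.tsum_lt_tsum (i := k) (fun j => ?_) ?_ (hs t) (hs s)
    · exact mul_le_mul_of_nonneg_right (hanti j hs' ht hst) (by positivity)
    · refine mul_lt_mul_of_pos_right ?_ (by positivity)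
      refine lt_of_le_of_lt (hH' k t ht t ⟨ht.1, le_rfl⟩) (lt_of_lt_of_le (b :=
        infDist (g t) (g '' Icc 0 s) / 2) (by rwa [dist_comm]) (hHle k s _ hs'.1 fun u hu => ?_))
      have e1 := infDist_le_dist_of_mem (x := g t) (mem_image_of_mem g hu)
      have e2 := dist_triangle (g t) (x k) (g u)
      change dist (g t) (x k) < _ at hk
      linarith
  refine ⟨fun t => ∑' k, H k t * (1 / 2 : ℝ) ^ k,
    continuous_tsum (fun k => (hHcont k).mul_const _) hsum hnorm, fun s hs' t ht hst => ?_, ?_⟩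
  · exact (hs t).tsum_le_tsum (fun k => mul_le_mul_of_nonneg_right (hanti k hs' ht hst)
      (by positivity)) (hs s)
  · have hconst : ∀ s ∈ Icc (0 : ℝ) 1, ∀ t ∈ Icc (0 : ℝ) 1, s ≤ t → g s = g t →
        ∑' k, H k s * (1 / 2 : ℝ) ^ k = ∑' k, H k t * (1 / 2 : ℝ) ^ k := by
      intro s hs' t ht hst h
      refine tsum_congr fun k => ?_
      congr 1
      refine le_antisymm (hHle k t _ ht.1 fun u hu => ?_) (hanti k hs' ht hst)
      rcases le_total u s with hus | hus
      · exact hH' k s hs' u ⟨hu.1, hus⟩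
      · rw [hmono s hs' t ht hst h u ⟨hus, hu.2⟩]
        exact hH' k s hs' s ⟨hs'.1, le_rfl⟩
    intro s hs' t ht
    dsimp only
    constructor
    · intro h
      by_contra hne
      rcases le_total s t with hst | hst
      · exact (hstrict s hs' t ht hst hne).ne' h
      · exact (hstrict t ht s hs' hst (Ne.symm hne)).ne h
    · intro h
      rcases le_total s t with hst | hst
      · exact hconst s hs' t ht hst h
      · exact (hconst t ht s hs' hst h.symm).symm

/-- Continuous surjections between compact Hausdorff spaces allow to descend continuous maps. -/
lemma exists_continuous_comp_eq {K A B : Type*} [TopologicalSpace K] [CompactSpace K]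
    [TopologicalSpace A] [T2Space A] [TopologicalSpace B] {p : K → A} {q : K → B}
    (hp : Continuous p) (hps : Function.Surjective p) (hq : Continuous q)
    (h : ∀ s t, p s = p t → q s = q t) : ∃ f : A → B, Continuous f ∧ ∀ s, f (p s) = q s := by
  have hqm : IsQuotientMap (⟨p, hp⟩ : C(K, A)) := hp.isClosedMap.isQuotientMap hp hps
  have hfac : Function.FactorsThrough (⟨q, hq⟩ : C(K, B)) (⟨p, hp⟩ : C(K, A)) :=
    fun s t hst => h s t hst
  exact ⟨hqm.lift ⟨q, hq⟩ hfac, ContinuousMap.continuous _,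
    fun s => DFunLike.congr_fun (hqm.lift_comp ⟨q, hq⟩ hfac) s⟩

/-- Points joined by a path are joined by an arc. -/
lemma JoinedIn.exists_isArc {X : Type*} [MetricSpace X] [CompactSpace X] {S : Set X} {a b : X}
    (h : JoinedIn S a b) (hab : a ≠ b) : ∃ A ⊆ S, IsArc A a b := by
  obtain ⟨g, hg, g0, g1, gim, gmono⟩ := exists_monotone_path h.somePath.continuous_extend
  rw [Path.extend_zero] at g0
  rw [Path.extend_one] at g1
  obtain ⟨φ, hφ, hanti, hφg⟩ := exists_height hg gmono
  have hI0 : (0 : ℝ) ∈ Icc (0 : ℝ) 1 := by simp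
  have hI1 : (1 : ℝ) ∈ Icc (0 : ℝ) 1 := by simp
  have hne : φ 0 ≠ φ 1 := fun h => hab (by rw [← g0, ← g1, ← hφg 0 hI0 1 hI1, h])
  have hlt : φ 1 < φ 0 := lt_of_le_of_ne (hanti hI0 hI1 zero_le_one) hne.symm
  have hpos : 0 < φ 0 - φ 1 := by linarith
  let ψ : ℝ → ℝ := fun t => (φ 0 - φ t) / (φ 0 - φ 1)
  have hψ : ∀ t ∈ Icc (0 : ℝ) 1, ψ t ∈ Icc (0 : ℝ) 1 := fun t ht =>
    ⟨div_nonneg (by linarith [hanti hI0 ht ht.1]) hpos.le,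
      (div_le_one hpos).2 (by linarith [hanti ht hI1 ht.2])⟩
  have hψφ : ∀ s t, ψ s = ψ t ↔ φ s = φ t := fun s t => by
    simp only [ψ]
    rw [div_left_inj' hpos.ne']
    constructor <;> intro <;> linarith
  have hsurj : ∀ c ∈ Icc (0 : ℝ) 1, ∃ t ∈ Icc (0 : ℝ) 1, ψ t = c := by
    intro c hc
    obtain ⟨t, ht, htc⟩ := intermediate_value_Icc' zero_le_one hφ.continuousOn
      (show φ 0 - c * (φ 0 - φ 1) ∈ Icc (φ 1) (φ 0) by
        constructor <;> nlinarith [hc.1, hc.2])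
    refine ⟨t, ht, ?_⟩
    simp only [ψ, htc]
    field_simp
    ring
  obtain ⟨f, hf, hfψ⟩ := exists_continuous_comp_eq (K := Icc (0 : ℝ) 1) (A := Icc (0 : ℝ) 1)
    (p := fun t => ⟨ψ t, hψ t t.2⟩) (q := fun t => g t)
    (Continuous.subtype_mk (by fun_prop) _)
    (fun c => (hsurj c c.2).elim fun t ht => ⟨⟨t, ht.1⟩, Subtype.ext ht.2⟩)
    (by fun_prop)
    (fun s t hst => (hφg s s.2 t t.2).1 ((hψφ s t).1 (Subtype.ext_iff.1 hst)))
  have hF : ∀ t ∈ Icc (0 : ℝ) 1, IccExtend zero_le_one f (ψ t) = g t := fun t ht => by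
    rw [IccExtend_of_mem _ _ (hψ t ht)]
    exact hfψ ⟨t, ht⟩
  refine ⟨_, ?_, IccExtend zero_le_one f, hf.Icc_extend'.continuousOn, ?_, ?_, ?_, rfl⟩
  · rintro _ ⟨c, hc, rfl⟩
    obtain ⟨t, ht, rfl⟩ := hsurj c hc
    rw [hF t ht]
    obtain ⟨u, hu, hut⟩ := gim ⟨t, ht, rfl⟩
    rw [← hut, Path.extend_apply _ hu]
    exact h.somePath_mem _
  · intro c hc d hd hcd
    obtain ⟨s, hs, rfl⟩ := hsurj c hc
    obtain ⟨t, ht, rfl⟩ := hsurj d hd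
    rw [hF s hs, hF t ht] at hcd
    exact (hψφ s t).2 ((hφg s hs t ht).2 hcd)
  · have : ψ 0 = 0 := by simp [ψ]
    exact (congrArg _ this.symm).trans ((hF 0 hI0).trans g0)
  · have : ψ 1 = 1 := by simp [ψ, hpos.ne']
    exact (congrArg _ this.symm).trans ((hF 1 hI1).trans g1)

namespace IsArc

variable {X : Type*} [TopologicalSpace X] {A B : Set X} {a b c : X}

lemma of_Icc {f : ℝ → X} {s t : ℝ} (hst : s < t) (hf : ContinuousOn f (Icc s t))
    (hinj : InjOn f (Icc s t)) : IsArc (f '' Icc s t) (f s) (f t) := by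
  have hpos : 0 < t - s := by linarith
  have hm : ∀ u ∈ Icc (0 : ℝ) 1, s + (t - s) * u ∈ Icc s t := fun u hu =>
    ⟨by nlinarith [hu.1], by nlinarith [hu.2]⟩
  refine ⟨fun u => f (s + (t - s) * u), hf.comp (by fun_prop) hm, fun u hu v hv h => ?_,
    by simp, by simp, Subset.antisymm ?_ ?_⟩
  · have := hinj (hm u hu) (hm v hv) h
    exact mul_left_cancel₀ hpos.ne' (by linarith)
  · rintro _ ⟨u, hu, rfl⟩
    exact ⟨_, hm u hu, rfl⟩
  · rintro _ ⟨v, hv, rfl⟩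
    refine ⟨(v - s) / (t - s), ⟨div_nonneg (by linarith [hv.1]) hpos.le,
      (div_le_one hpos).2 (by linarith [hv.2])⟩, ?_⟩
    dsimp only
    rw [mul_div_cancel₀ _ hpos.ne']
    simp

lemma exists_continuous (h : IsArc A a b) : ∃ f : ℝ → X, Continuous f ∧ InjOn f (Icc 0 1) ∧
    f 0 = a ∧ f 1 = b ∧ f '' Icc 0 1 = A := by
  obtain ⟨f, hf, hinj, h0, h1, him⟩ := h
  have hext : EqOn (IccExtend zero_le_one ((Icc (0 : ℝ) 1).domRestrict f)) f (Icc 0 1) :=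
    fun t ht => by rw [IccExtend_of_mem _ _ ht, domRestrict_apply]
  exact ⟨_, hf.domRestrict.Icc_extend', hext.injOn_iff.2 hinj, (hext (by simp)).trans h0,
    (hext (by simp)).trans h1, hext.image_eq.trans him⟩

lemma symm (h : IsArc A a b) : IsArc A b a := by
  obtain ⟨f, hf, hinj, rfl, rfl, rfl⟩ := h
  have hm : ∀ u ∈ Icc (0 : ℝ) 1, 1 - u ∈ Icc (0 : ℝ) 1 := fun u hu =>
    ⟨by linarith [hu.2], by linarith [hu.1]⟩
  refine ⟨fun u => f (1 - u), hf.comp (by fun_prop) hm, fun u hu v hv h => ?_,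
    by simp, by simp, Subset.antisymm ?_ ?_⟩
  · linarith [hinj (hm u hu) (hm v hv) h]
  · rintro _ ⟨u, hu, rfl⟩
    exact ⟨_, hm u hu, rfl⟩
  · rintro _ ⟨u, hu, rfl⟩
    exact ⟨_, hm u hu, by simp⟩

lemma ne (h : IsArc A a b) : a ≠ b := by
  obtain ⟨f, -, hinj, rfl, rfl, -⟩ := h
  exact fun h => zero_ne_one (hinj (by simp) (by simp) h)

lemma left_mem (h : IsArc A a b) : a ∈ A := by
  obtain ⟨f, -, -, rfl, -, rfl⟩ := h
  exact ⟨0, by simp, rfl⟩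

lemma right_mem (h : IsArc A a b) : b ∈ A := h.symm.left_mem

lemma isCompact (h : IsArc A a b) : IsCompact A := by
  obtain ⟨f, hf, -, -, -, rfl⟩ := h
  exact isCompact_Icc.image_of_continuousOn hf

lemma isPreconnected (h : IsArc A a b) : IsPreconnected A := by
  obtain ⟨f, hf, -, -, -, rfl⟩ := h
  exact isPreconnected_Icc.image _ hf

lemma isPathConnected (h : IsArc A a b) : IsPathConnected A := by
  obtain ⟨f, hf, -, -, -, rfl⟩ := h.exists_continuous
  exact ((convex_Icc 0 1).isPathConnected (by simp)).image hf

/-- An interior point splits an arc into two arcs. -/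
lemma split (h : IsArc A a b) {p : X} (hp : p ∈ A) (hpa : p ≠ a) (hpb : p ≠ b) :
    ∃ A₁ A₂, IsArc A₁ a p ∧ IsArc A₂ p b ∧ A₁ ∪ A₂ = A ∧ A₁ ∩ A₂ = {p} := by
  obtain ⟨f, hf, hinj, rfl, rfl, rfl⟩ := h
  obtain ⟨t, ht, rfl⟩ := hp
  have h0 : 0 < t := lt_of_le_of_ne ht.1 (by rintro rfl; exact hpa rfl)
  have h1 : t < 1 := lt_of_le_of_ne ht.2 (by rintro rfl; exact hpb rfl)
  have s1 : Icc 0 t ⊆ Icc 0 1 := Icc_subset_Icc le_rfl h1.le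
  have s2 : Icc t 1 ⊆ Icc 0 1 := Icc_subset_Icc h0.le le_rfl
  refine ⟨f '' Icc 0 t, f '' Icc t 1, of_Icc h0 (hf.mono s1) (hinj.mono s1),
    of_Icc h1 (hf.mono s2) (hinj.mono s2), ?_, ?_⟩
  · rw [← image_union, Icc_union_Icc_eq_Icc h0.le h1.le]
  · rw [← hinj.image_inter s1 s2, Icc_inter_Icc_eq_singleton h0.le h1.le, image_singleton]

lemma concat (hA : IsArc A a b) (hB : IsArc B b c) (hAB : A ∩ B ⊆ {b}) :
    IsArc (A ∪ B) a c := by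
  obtain ⟨f, hf, hfi, rfl, rfl, rfl⟩ := hA.exists_continuous
  obtain ⟨g, hg, hgi, hgb, rfl, rfl⟩ := hB.exists_continuous
  let h : ℝ → X := fun t => if t ≤ 1 then f t else g (t - 1)
  have hc : Continuous h := hf.if_le (by fun_prop) continuous_id continuous_const (by
    rintro t rfl; simp [hgb])
  have hle : ∀ t ≤ 1, h t = f t := fun t ht => if_pos ht
  have hge : ∀ t, 1 ≤ t → h t = g (t - 1) := fun t ht => by
    rcases ht.eq_or_lt with rfl | ht
    · simp [h, hgb]
    · exact if_neg ht.not_ge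
  have key : ∀ s ∈ Icc (0 : ℝ) 2, ∀ t ∈ Icc (0 : ℝ) 2, s ≤ t → h s = h t → s = t := by
    intro s hs t ht hst hh
    rcases le_total t 1 with h1 | h1
    · rw [hle s (hst.trans h1), hle t h1] at hh
      exact hfi ⟨hs.1, hst.trans h1⟩ ⟨ht.1, h1⟩ hh
    have ht' : t - 1 ∈ Icc (0 : ℝ) 1 := ⟨by linarith, by linarith [ht.2]⟩
    rcases le_total s 1 with h2 | h2
    · rw [hle s h2, hge t h1] at hh
      have hs' : s ∈ Icc (0 : ℝ) 1 := ⟨hs.1, h2⟩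
      have e := hAB ⟨⟨s, hs', rfl⟩, ⟨t - 1, ht', hh.symm⟩⟩
      rw [mem_singleton_iff] at e
      have e1 := hfi hs' (by simp) e
      have e2 := hgi ht' (by simp : (0 : ℝ) ∈ Icc (0 : ℝ) 1) ((hh.symm.trans e).trans hgb.symm)
      linarith
    · rw [hge s h2, hge t h1] at hh
      have := hgi ⟨by linarith, by linarith [hs.2]⟩ ht' hh
      linarith
  have hinj : InjOn h (Icc 0 2) := fun s hs t ht hh =>
    (le_total s t).elim (fun h => key s hs t ht h hh) (fun h => (key t ht s hs h hh.symm).symm)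
  have e0 : h 0 = f 0 := hle 0 zero_le_one
  have e2 : h 2 = g 1 := by rw [hge 2 one_le_two]; norm_num
  have := of_Icc two_pos hc.continuousOn hinj
  rw [e0, e2] at this
  convert this using 1
  rw [← Icc_union_Icc_eq_Icc zero_le_one one_le_two, image_union]
  congr 1
  · exact image_congr fun t ht => (hle t ht.2).symm
  · ext x
    constructor
    · rintro ⟨t, ht, rfl⟩
      exact ⟨t + 1, ⟨by linarith [ht.1], by linarith [ht.2]⟩, by
        rw [hge _ (by linarith [ht.1])]; simp⟩
    · rintro ⟨t, ht, rfl⟩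
      exact ⟨t - 1, ⟨by linarith [ht.1], by linarith [ht.2]⟩, (hge t ht.1).symm⟩

/-- The initial part of an arc up to the first point in a closed set. -/
lemma exists_first_mem (h : IsArc A a b) {K : Set X} (hK : IsClosed K) (ha : a ∉ K)
    (hb : b ∈ K) : ∃ c ∈ K, ∃ A' ⊆ A, IsArc A' a c ∧ A' ∩ K = {c} := by
  obtain ⟨f, hf, hinj, rfl, rfl, rfl⟩ := h.exists_continuous
  obtain ⟨t, ⟨ht, htK⟩, hmin⟩ := (isCompact_Icc.inter_right (hK.preimage hf)).exists_isLeast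
    (s := Icc (0 : ℝ) 1 ∩ f ⁻¹' K) ⟨1, by simp, hb⟩
  have h0 : 0 < t := lt_of_le_of_ne ht.1 (by rintro rfl; exact ha htK)
  have hs : Icc 0 t ⊆ Icc 0 1 := Icc_subset_Icc le_rfl ht.2
  refine ⟨f t, htK, f '' Icc 0 t, image_mono hs, of_Icc h0 hf.continuousOn (hinj.mono hs), ?_⟩
  refine Subset.antisymm ?_ (singleton_subset_iff.2 ⟨⟨t, ⟨ht.1, le_rfl⟩, rfl⟩, htK⟩)
  rintro _ ⟨⟨s, hs', rfl⟩, hsK⟩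
  rw [mem_singleton_iff, le_antisymm hs'.2 (hmin ⟨hs hs', hsK⟩)]

/-- Two arcs with the same endpoints which are otherwise disjoint form a Jordan curve. -/
lemma isJordanCurve_union [T2Space X] (hA : IsArc A a b) (hB : IsArc B a b)
    (hAB : A ∩ B ⊆ {a, b}) : IsJordanCurve (A ∪ B) := by
  obtain ⟨f, hf, hfi, rfl, rfl, rfl⟩ := hA.exists_continuous
  obtain ⟨g, hg, hgi, hg0, hg1, rfl⟩ := hB.exists_continuous
  have hsq : ∀ v : Circle1, v.1 0 ^ 2 + v.1 1 ^ 2 = 1 := fun v => by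
    have : v.1 ∈ Metric.sphere (0 : EuclideanSpace ℝ (Fin 2)) 1 := v.2
    rw [EuclideanSpace.sphere_zero_eq _ zero_le_one] at this
    simpa [Fin.sum_univ_two] using this
  have hpar : ∀ v : Circle1, (1 + v.1 0) / 2 ∈ Icc (0 : ℝ) 1 := fun v =>
    ⟨by nlinarith [hsq v, sq_nonneg (v.1 1)], by nlinarith [hsq v, sq_nonneg (v.1 1)]⟩
  let F : Circle1 → X := fun v =>
    if 0 ≤ v.1 1 then f ((1 + v.1 0) / 2) else g ((1 + v.1 0) / 2)
  have hpos : ∀ v : Circle1, 0 ≤ v.1 1 → F v = f ((1 + v.1 0) / 2) := fun v h => if_pos h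
  have hneg : ∀ v : Circle1, v.1 1 ≤ 0 → F v = g ((1 + v.1 0) / 2) := fun v h => by
    rcases h.eq_or_lt with h | h
    · rw [hpos v h.ge]
      have : v.1 0 = 1 ∨ v.1 0 = -1 := by
        have := hsq v
        rw [h] at this
        exact mul_self_eq_one_iff.1 (by linarith)
      rcases this with h | h <;> simp [h, hg0, hg1]
    · exact if_neg h.not_ge
  have hF : Continuous F := by
    refine Continuous.if_le (by fun_prop) (by fun_prop) continuous_const (by fun_prop) ?_
    intro v h
    rw [← hpos v h.le, hneg v h.ge]
  have hext : ∀ v w : Circle1, v.1 0 = w.1 0 → v.1 1 = w.1 1 → v = w := fun v w h0 h1 => by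
    ext i
    fin_cases i
    · exact h0
    · exact h1
  have hmix : ∀ v w : Circle1, 0 ≤ v.1 1 → w.1 1 ≤ 0 → F v = F w → v = w := by
    intro v w hv hw h
    have h' := h
    rw [hpos v hv, hneg w hw] at h
    have e0 : f ((1 + v.1 0) / 2) = f 0 ∨ f ((1 + v.1 0) / 2) = f 1 :=
      hAB ⟨⟨_, hpar v, rfl⟩, ⟨_, hpar w, h.symm⟩⟩
    have fin : ∀ r : ℝ, r ^ 2 = 1 → (1 + v.1 0) / 2 = (1 + r) / 2 →
        (1 + w.1 0) / 2 = (1 + r) / 2 → v = w := by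
      intro r hr hv hw
      have hv0 : v.1 0 = r := by linarith
      have hw0 : w.1 0 = r := by linarith
      refine hext v w (hv0.trans hw0.symm) ?_
      have e1 := hsq v
      have e2 := hsq w
      rw [hv0, hr] at e1
      rw [hw0, hr] at e2
      rw [pow_eq_zero_iff two_ne_zero |>.1 (by linarith : v.1 1 ^ 2 = 0),
        pow_eq_zero_iff two_ne_zero |>.1 (by linarith : w.1 1 ^ 2 = 0)]
    rcases e0 with e | e
    · refine fin (-1) (by norm_num) ?_ ?_
      · rw [hfi (hpar v) (by simp) e]; norm_num
      · rw [hgi (hpar w) (by simp : (0 : ℝ) ∈ _) ((h.symm.trans e).trans hg0.symm)]; norm_num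
    · refine fin 1 (by norm_num) ?_ ?_
      · rw [hfi (hpar v) (by simp) e]; norm_num
      · rw [hgi (hpar w) (by simp : (1 : ℝ) ∈ _) ((h.symm.trans e).trans hg1.symm)]; norm_num
  have hinj : Function.Injective F := by
    intro v w h
    have hs := hsq v
    have hs' := hsq w
    rcases le_total 0 (v.1 1) with hv | hv <;> rcases le_total 0 (w.1 1) with hw | hw
    · rw [hpos v hv, hpos w hw] at h
      have e : v.1 0 = w.1 0 := by linarith [hfi (hpar v) (hpar w) h]
      rw [e] at hs
      exact hext v w e ((sq_eq_sq₀ hv hw).1 (by linarith))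
    · exact hmix v w hv hw h
    · exact (hmix w v hw hv h.symm).symm
    · rw [hneg v hv, hneg w hw] at h
      have e : v.1 0 = w.1 0 := by linarith [hgi (hpar v) (hpar w) h]
      rw [e] at hs
      exact hext v w e (neg_injective ((sq_eq_sq₀ (neg_nonneg.2 hv) (neg_nonneg.2 hw)).1
        (by linarith)))
  have hmem : ∀ t ∈ Icc (0 : ℝ) 1, ∀ ε : ℝ, ε ^ 2 = 1 → ∃ v : Circle1, v.1 0 = 2 * t - 1 ∧
      v.1 1 = ε * √(1 - (2 * t - 1) ^ 2) := by
    intro t ht ε hε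
    refine ⟨⟨!₂[2 * t - 1, ε * √(1 - (2 * t - 1) ^ 2)], ?_⟩, by simp, by simp⟩
    rw [Circle1, EuclideanSpace.sphere_zero_eq _ zero_le_one]
    have : 0 ≤ 1 - (2 * t - 1) ^ 2 := by nlinarith [ht.1, ht.2]
    simp [Fin.sum_univ_two, mul_pow, Real.sq_sqrt this, hε]
  have hrange : range F = f '' Icc 0 1 ∪ g '' Icc 0 1 := by
    apply Subset.antisymm
    · rintro _ ⟨v, rfl⟩
      rcases le_total 0 (v.1 1) with hv | hv
      · exact Or.inl ⟨_, hpar v, (hpos v hv).symm⟩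
      · exact Or.inr ⟨_, hpar v, (hneg v hv).symm⟩
    · rintro _ (⟨t, ht, rfl⟩ | ⟨t, ht, rfl⟩)
      · obtain ⟨v, h0, h1⟩ := hmem t ht 1 (by norm_num)
        refine ⟨v, ?_⟩
        rw [hpos v (by rw [h1]; positivity), h0]
        congr 1; ring
      · obtain ⟨v, h0, h1⟩ := hmem t ht (-1) (by norm_num)
        refine ⟨v, ?_⟩
        rw [hneg v (by rw [h1]; linarith [Real.sqrt_nonneg (1 - (2 * t - 1) ^ 2)]), h0]
        congr 1; ring
  have : CompactSpace Circle1 := isCompact_iff_compactSpace.1 (isCompact_sphere _ _)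
  rw [← hrange]
  exact ⟨(hF.isClosedEmbedding hinj).isEmbedding.toHomeomorph.symm⟩

end IsArc

namespace IsJordanCurve

variable {X : Type*} [TopologicalSpace X] {J : Set X}

lemma exists_periodic (h : IsJordanCurve J) : ∃ φ : ℝ → X, Continuous φ ∧
    (∀ s t, φ s = φ t ↔ ∃ k : ℤ, s - t = 2 * Real.pi * k) ∧ range φ = J := by
  obtain ⟨e⟩ := h
  have hmem : ∀ t : ℝ, !₂[Real.cos t, Real.sin t] ∈ Circle1 := fun t => by
    rw [Circle1, EuclideanSpace.sphere_zero_eq _ zero_le_one]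
    simp [Fin.sum_univ_two]
  refine ⟨fun t => e.symm ⟨_, hmem t⟩, ?_, fun s t => ?_, Subset.antisymm ?_ ?_⟩
  · refine continuous_subtype_val.comp (e.symm.continuous.comp (Continuous.subtype_mk ?_ _))
    refine (PiLp.continuous_toLp 2 _).comp (continuous_pi fun i => ?_)
    fin_cases i
    · exact Real.continuous_cos
    · exact Real.continuous_sin
  · rw [← Real.Angle.angle_eq_iff_two_pi_dvd_sub]
    constructor
    · intro h
      have h' := Subtype.ext_iff.1 (e.symm.injective (Subtype.ext h))
      have h0 := congrArg (fun v : EuclideanSpace ℝ (Fin 2) => v 0) h'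
      have h1 := congrArg (fun v : EuclideanSpace ℝ (Fin 2) => v 1) h'
      exact Real.Angle.cos_sin_inj (by simpa using h0) (by simpa using h1)
    · intro h
      have h0 := congrArg Real.Angle.cos h
      have h1 := congrArg Real.Angle.sin h
      simp only [Real.Angle.cos_coe, Real.Angle.sin_coe] at h0 h1
      simp only [h0, h1]
  · rintro _ ⟨t, rfl⟩
    exact Subtype.coe_prop _
  · intro x hx
    have hs : (e ⟨x, hx⟩).1 ∈ Metric.sphere (0 : EuclideanSpace ℝ (Fin 2)) 1 := (e ⟨x, hx⟩).2
    rw [EuclideanSpace.sphere_zero_eq _ zero_le_one] at hs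
    have hs : (e ⟨x, hx⟩).1 0 ^ 2 + (e ⟨x, hx⟩).1 1 ^ 2 = 1 := by
      simpa [Fin.sum_univ_two] using hs
    let z : ℂ := ⟨(e ⟨x, hx⟩).1 0, (e ⟨x, hx⟩).1 1⟩
    have hz : ‖z‖ = 1 := by
      rw [← sq_eq_sq₀ (norm_nonneg _) zero_le_one, Complex.sq_norm, Complex.normSq_apply]
      simp only [z]
      linarith
    have h0 := Complex.norm_mul_cos_arg z
    have h1 := Complex.norm_mul_sin_arg z
    rw [hz, one_mul] at h0 h1
    refine ⟨z.arg, ?_⟩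
    have : (⟨_, hmem z.arg⟩ : Circle1) = e ⟨x, hx⟩ := by
      ext i
      fin_cases i
      · exact h0
      · exact h1
    simp only [this, e.symm_apply_apply]

/-- Two points of a Jordan curve split it into two arcs. -/
lemma exists_isArc_isArc (h : IsJordanCurve J) {a b : X} (ha : a ∈ J) (hb : b ∈ J)
    (hab : a ≠ b) : ∃ A B, IsArc A a b ∧ IsArc B a b ∧ A ∪ B = J ∧ A ∩ B = {a, b} := by
  obtain ⟨φ, hφ, hper, rfl⟩ := h.exists_periodic
  obtain ⟨s, rfl⟩ := ha
  obtain ⟨t', rfl⟩ := hb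
  have hpi := Real.two_pi_pos
  have hred : ∀ x, ∃ t ∈ Ico s (s + 2 * Real.pi), φ t = φ x := fun x =>
    ⟨_, toIcoMod_mem_Ico hpi s x, (hper _ _).2 ⟨-toIcoDiv hpi s x, by
      rw [toIcoMod_sub_self]; simp [mul_comm]⟩⟩
  obtain ⟨t, ht, htt⟩ := hred t'
  rw [← htt] at hab ⊢
  have hst : s < t := lt_of_le_of_ne ht.1 (by rintro rfl; exact hab rfl)
  have hper' : φ (s + 2 * Real.pi) = φ s := (hper _ _).2 ⟨1, by simp⟩
  have key : ∀ u v, u ≤ v → φ u = φ v → v ≤ u + 2 * Real.pi → v = u ∨ v = u + 2 * Real.pi := by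
    intro u v huv h hle
    obtain ⟨k, hk⟩ := (hper v u).1 h.symm
    have h0 : 0 ≤ k := by
      by_contra! h
      have : (k : ℝ) ≤ -1 := by exact_mod_cast Int.le_sub_one_of_lt h
      nlinarith
    have h1 : k ≤ 1 := by
      by_contra! h
      have : (2 : ℝ) ≤ k := by exact_mod_cast h
      nlinarith
    interval_cases k
    · left; simpa [sub_eq_zero] using hk
    · right; simp at hk; linarith
  have hinj : ∀ l r, r < l + 2 * Real.pi → InjOn φ (Icc l r) := by
    intro l r hlr u hu v hv h
    rcases le_total u v with huv | huv
    · rcases key u v huv h (by linarith [hu.1, hv.2]) with h | h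
      · exact h.symm
      · linarith [hu.1, hv.2]
    · rcases key v u huv h.symm (by linarith [hv.1, hu.2]) with h | h
      · exact h
      · linarith [hv.1, hu.2]
  have hB := (IsArc.of_Icc ht.2 hφ.continuousOn (hinj _ _ (by linarith))).symm
  rw [hper'] at hB
  refine ⟨φ '' Icc s t, φ '' Icc t (s + 2 * Real.pi),
    IsArc.of_Icc hst hφ.continuousOn (hinj _ _ ht.2), hB, ?_, ?_⟩
  · rw [← image_union, Icc_union_Icc_eq_Icc hst.le ht.2.le]
    refine Subset.antisymm (image_subset_range _ _) ?_
    rintro _ ⟨x, rfl⟩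
    obtain ⟨u, hu, hux⟩ := hred x
    exact ⟨u, ⟨hu.1, hu.2.le⟩, hux⟩
  · apply Subset.antisymm
    · rintro _ ⟨⟨u, hu, rfl⟩, ⟨v, hv, hvu⟩⟩
      rcases key u v (hu.2.trans hv.1) hvu.symm (by linarith [hu.1, hv.2]) with h | h
      · rw [le_antisymm hu.2 (by linarith [hv.1])]; simp
      · rw [le_antisymm (by linarith [hv.2]) hu.1]; simp
    · rintro _ (rfl | rfl)
      · exact ⟨⟨s, ⟨le_rfl, hst.le⟩, rfl⟩, ⟨_, ⟨ht.2.le, le_rfl⟩, hper'⟩⟩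
      · exact ⟨⟨t, ⟨hst.le, le_rfl⟩, rfl⟩, ⟨t, ⟨le_rfl, ht.2.le⟩, rfl⟩⟩

lemma isPreconnected (h : IsJordanCurve J) : IsPreconnected J := by
  obtain ⟨φ, hφ, -, rfl⟩ := h.exists_periodic
  exact isPreconnected_range hφ

lemma isClosed [T2Space X] (h : IsJordanCurve J) : IsClosed J := by
  obtain ⟨e⟩ := h
  have : CompactSpace Circle1 := isCompact_iff_compactSpace.1 (isCompact_sphere _ _)
  have : CompactSpace J := e.symm.compactSpace
  exact (isCompact_iff_compactSpace.2 this).isClosed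

end IsJordanCurve

/-! ## Cyclic elements -/

section CyclicElements

variable {X : Type*}

lemma IsArc.exists_mem_ne [TopologicalSpace X] {A : Set X} {a b : X} (h : IsArc A a b) :
    ∃ p ∈ A, p ≠ a ∧ p ≠ b := by
  obtain ⟨f, -, hinj, rfl, rfl, rfl⟩ := h
  have hm : (1 / 2 : ℝ) ∈ Icc (0 : ℝ) 1 := by constructor <;> norm_num
  refine ⟨f (1 / 2), ⟨_, hm, rfl⟩, fun h => ?_, fun h => ?_⟩
  · have := hinj hm (by simp) h
    norm_num at this
  · have := hinj hm (by simp) h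
    norm_num at this

/-- In a cyclicly connected set, any two points are joined by an arc through a given point. -/
lemma CycliclyConnected.exists_isArc_mem [TopologicalSpace X] [T2Space X] {T : Set X}
    (hT : CycliclyConnected T) {a b y : X} (ha : a ∈ T) (hb : b ∈ T) (hy : y ∈ T) (hab : a ≠ b) :
    ∃ A ⊆ T, IsArc A a b ∧ y ∈ A := by
  have of_mem : ∀ J ⊆ T, IsJordanCurve J → a ∈ J → b ∈ J → y ∈ J →
      ∃ A ⊆ T, IsArc A a b ∧ y ∈ A := by
    intro J hJT hJ haJ hbJ hyJ
    obtain ⟨A, B, hA, hB, rfl, -⟩ := hJ.exists_isArc_isArc haJ hbJ hab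
    rcases hyJ with h | h
    · exact ⟨A, subset_union_left.trans hJT, hA, h⟩
    · exact ⟨B, subset_union_right.trans hJT, hB, h⟩
  by_cases hya : y = a
  · obtain ⟨J, hJT, hJ, haJ, hbJ⟩ := hT a ha b hb hab
    exact of_mem J hJT hJ haJ hbJ (hya ▸ haJ)
  by_cases hyb : y = b
  · obtain ⟨J, hJT, hJ, haJ, hbJ⟩ := hT a ha b hb hab
    exact of_mem J hJT hJ haJ hbJ (hyb ▸ hbJ)
  obtain ⟨J, hJT, hJ, haJ, hyJ⟩ := hT a ha y hy (Ne.symm hya)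
  by_cases hbJ : b ∈ J
  · exact of_mem J hJT hJ haJ hbJ hyJ
  obtain ⟨J', hJ'T, hJ', hbJ', hyJ'⟩ := hT b hb y hy (Ne.symm hyb)
  obtain ⟨e, heJ, hea, B, hBT, hB, hBJ⟩ : ∃ e ∈ J, e ≠ a ∧ ∃ B ⊆ T, IsArc B b e ∧
      B ∩ J = {e} := by
    obtain ⟨B₁, B₂, hB₁, hB₂, rfl, hB⟩ := hJ'.exists_isArc_isArc hbJ' hyJ' (Ne.symm hyb)
    obtain ⟨c, hcJ, C, hC, hCarc, hCJ⟩ := hB₁.exists_first_mem hJ.isClosed hbJ hyJ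
    obtain ⟨d, hdJ, D, hD, hDarc, hDJ⟩ := hB₂.exists_first_mem hJ.isClosed hbJ hyJ
    by_cases hca : c = a
    · refine ⟨d, hdJ, fun hda => ?_, D, (hD.trans subset_union_right).trans hJ'T, hDarc, hDJ⟩
      have : a ∈ B₁ ∩ B₂ := ⟨hC (hca ▸ hCarc.right_mem), hD (hda ▸ hDarc.right_mem)⟩
      rw [hB] at this
      rcases this with h | h
      · exact hab h
      · exact hya h.symm
    · exact ⟨c, hcJ, hca, C, (hC.trans subset_union_left).trans hJ'T, hCarc, hCJ⟩
  obtain ⟨A₁, A₂, hA₁, hA₂, hAJ, hA⟩ := hJ.exists_isArc_isArc haJ hyJ (Ne.symm hya)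
  have finish : ∀ A ⊆ J, IsArc A a e → y ∈ A → ∃ A ⊆ T, IsArc A a b ∧ y ∈ A := by
    intro A hAJ hA hyA
    refine ⟨A ∪ B, union_subset (hAJ.trans hJT) hBT, hA.concat hB.symm ?_, Or.inl hyA⟩
    rw [← hBJ, inter_comm]
    exact inter_subset_inter_right _ hAJ
  by_cases hey : e = y
  · exact finish A₁ (hAJ ▸ subset_union_left) (hey ▸ hA₁) hA₁.right_mem
  have key : ∀ A₁ A₂, IsArc A₁ a y → IsArc A₂ a y → A₁ ∪ A₂ = J → A₁ ∩ A₂ = {a, y} → e ∈ A₂ →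
      ∃ A ⊆ T, IsArc A a b ∧ y ∈ A := by
    intro A₁ A₂ hA₁ hA₂ hAJ hA he
    obtain ⟨P, Q, hP, hQ, rfl, hPQ⟩ := hA₂.split he hea hey
    refine finish (A₁ ∪ Q) ?_ (hA₁.concat hQ.symm ?_) (Or.inl hA₁.right_mem)
    · rw [← hAJ]
      exact union_subset_union_right _ subset_union_right
    · rintro x ⟨hx₁, hxQ⟩
      have : x ∈ A₁ ∩ (P ∪ Q) := ⟨hx₁, Or.inr hxQ⟩
      rw [hA] at this
      rcases this with rfl | h
      · have : x ∈ P ∩ Q := ⟨hP.left_mem, hxQ⟩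
        rw [hPQ] at this
        exact absurd this.symm hea
      · exact h
  rcases (hAJ ▸ heJ : e ∈ A₁ ∪ A₂) with he | he
  · exact key A₂ A₁ hA₂ hA₁ (by rwa [union_comm]) (by rwa [inter_comm]) he
  · exact key A₁ A₂ hA₁ hA₂ hAJ hA he

lemma CycliclyConnected.union_isArc [TopologicalSpace X] [T2Space X] {T A : Set X} {a b : X}
    (hT : CycliclyConnected T) (hA : IsArc A a b) (ha : a ∈ T) (hb : b ∈ T)
    (hAT : A ∩ T ⊆ {a, b}) : CycliclyConnected (T ∪ A) := by
  have key : ∀ x ∈ T, ∃ J ⊆ T ∪ A, IsJordanCurve J ∧ x ∈ J ∧ A ⊆ J := by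
    intro x hx
    obtain ⟨B, hBT, hB, hxB⟩ := hT.exists_isArc_mem ha hb hx hA.ne
    refine ⟨B ∪ A, union_subset_union_left _ hBT, hB.isJordanCurve_union hA ?_, Or.inl hxB,
      subset_union_right⟩
    rw [inter_comm]
    exact (inter_subset_inter_right _ hBT).trans hAT
  rintro x (hx | hx) y (hy | hy) hxy
  · obtain ⟨J, hJT, hJ⟩ := hT x hx y hy hxy
    exact ⟨J, hJT.trans subset_union_left, hJ⟩
  · obtain ⟨J, hJT, hJ, hxJ, hAJ⟩ := key x hx
    exact ⟨J, hJT, hJ, hxJ, hAJ hy⟩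
  · obtain ⟨J, hJT, hJ, hyJ, hAJ⟩ := key y hy
    exact ⟨J, hJT, hJ, hAJ hx, hyJ⟩
  · obtain ⟨J, hJT, hJ, -, hAJ⟩ := key a ha
    exact ⟨J, hJT, hJ, hAJ hx, hAJ hy⟩

lemma IsMaximalCyclic.not_inter_subset [TopologicalSpace X] [T2Space X] {T A : Set X} {a b : X}
    (hT : IsMaximalCyclic T) (hA : IsArc A a b) (ha : a ∈ T) (hb : b ∈ T) :
    ¬ A ∩ T ⊆ {a, b} := by
  intro hAT
  have heq := hT.2.2 _ (hT.2.1.union_isArc hA ha hb hAT) subset_union_left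
  obtain ⟨p, hp, hpa, hpb⟩ := hA.exists_mem_ne
  rcases hAT ⟨hp, heq ▸ Or.inr hp⟩ with h | h
  · exact hpa h
  · exact hpb h

lemma exists_isOpen_isConnected_subset [TopologicalSpace X] [LocallyConnectedSpace X] {x : X}
    {U : Set X} (hU : IsOpen U) (hx : x ∈ U) : ∃ V ⊆ U, IsOpen V ∧ IsConnected V ∧ x ∈ V :=
  ⟨_, connectedComponentIn_subset U x, hU.connectedComponentIn,
    isConnected_connectedComponentIn_iff.2 hx, mem_connectedComponentIn hx⟩

variable [MetricSpace X] [CompactSpace X] [LocallyConnectedSpace X] {T T' : Set X}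

/-- A connected open set missing a maximal cyclic set `T` has at most one limit point in `T`. -/
lemma IsMaximalCyclic.subsingleton_inter_closure (hT : IsMaximalCyclic T) (hTc : IsClosed T)
    {W : Set X} (hW : IsOpen W) (hWc : IsConnected W) (hWT : Disjoint W T) :
    (T ∩ closure W).Subsingleton := by
  have := locallyPathConnectedSpace_of_complete (X := X)
  have path : ∀ {V : Set X}, IsOpen V → IsConnected V → IsPathConnected V :=
    fun hV => hV.isConnected_iff_isPathConnected.1
  have access : ∀ V : Set X, IsOpen V → IsConnected V → ∀ p ∈ V, p ∈ T → p ∈ closure W →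
      ∃ w ∈ W, ∃ p' ∈ T, ∃ A ⊆ V, IsArc A w p' ∧ A ∩ T = {p'} := by
    intro V hV hVc p hpV hpT hpW
    obtain ⟨w, hwV, hwW⟩ := mem_closure_iff.1 hpW V hV hpV
    have hwT : w ∉ T := Set.disjoint_left.1 hWT hwW
    obtain ⟨A, hAV, hA⟩ := ((path hV hVc).joinedIn w hwV p hpV).exists_isArc
      (by rintro rfl; exact hwT hpT)
    obtain ⟨p', hp', A', hA'A, hA', hA'T⟩ := hA.exists_first_mem hTc hwT hpT
    exact ⟨w, hwW, p', hp', A', hA'A.trans hAV, hA', hA'T⟩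
  rintro p ⟨hpT, hpW⟩ q ⟨hqT, hqW⟩
  by_contra hpq
  obtain ⟨U, U', hU, hU', hpU, hqU', hd⟩ := t2_separation hpq
  obtain ⟨V, hVU, hV, hVc, hpV⟩ := exists_isOpen_isConnected_subset hU hpU
  obtain ⟨V', hVU', hV', hVc', hqV'⟩ := exists_isOpen_isConnected_subset hU' hqU'
  obtain ⟨w, hwW, p', hp', A, hAV, hA, hAT⟩ := access V hV hVc p hpV hpT hpW
  obtain ⟨w', hwW', q', hq', A', hAV', hA', hAT'⟩ := access V' hV' hVc' q hqV' hqT hqW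
  have hne : p' ≠ q' := by
    rintro rfl
    exact Set.disjoint_left.1 hd (hVU (hAV hA.right_mem)) (hVU' (hAV' hA'.right_mem))
  have hS : IsPathConnected (A ∪ W ∪ A') :=
    (hA.isPathConnected.union (path hW hWc) ⟨w, hA.left_mem, hwW⟩).union hA'.isPathConnected
      ⟨w', Or.inr hwW', hA'.left_mem⟩
  obtain ⟨B, hBS, hB⟩ := (hS.joinedIn p' (Or.inl (Or.inl hA.right_mem)) q'
    (Or.inr hA'.right_mem)).exists_isArc hne
  refine hT.not_inter_subset hB hp' hq' ?_
  rintro x ⟨hxB, hxT⟩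
  rcases hBS hxB with (h | h) | h
  · exact Or.inl (hAT ▸ ⟨h, hxT⟩ : x ∈ ({p'} : Set X))
  · exact absurd hxT (Set.disjoint_left.1 hWT h)
  · exact Or.inr (hAT' ▸ ⟨h, hxT⟩ : x ∈ ({q'} : Set X))

/-- Every connected set through `z` meeting the maximal cyclic set `T` passes through a fixed
point of `T`. -/
lemma IsMaximalCyclic.exists_gate [ConnectedSpace X] (hT : IsMaximalCyclic T) (hTc : IsClosed T)
    (z : X) : ∃ p ∈ T, ∀ C, IsPreconnected C → z ∈ C → (T ∩ C).Nonempty → p ∈ C := by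
  by_cases hz : z ∈ T
  · exact ⟨z, hz, fun C _ h _ => h⟩
  set W := connectedComponentIn Tᶜ z with hWdef
  have hW : IsOpen W := hTc.isOpen_compl.connectedComponentIn
  have hWc : IsConnected W := isConnected_connectedComponentIn_iff.2 hz
  have hzW : z ∈ W := mem_connectedComponentIn hz
  have hWT : W ⊆ Tᶜ := connectedComponentIn_subset _ _
  have hsub := hT.subsingleton_inter_closure hTc hW hWc (disjoint_compl_left.mono_left hWT)
  have hcl : closure W ∩ Tᶜ ⊆ W := by
    rintro x ⟨hx, hxT⟩
    have hc : IsPreconnected (insert x W) := hWc.isPreconnected.subset_closure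
      (subset_insert _ _) (insert_subset hx subset_closure)
    exact hc.subset_connectedComponentIn (Or.inr hzW) (insert_subset hxT hWT) (mem_insert _ _)
  have key : ∀ C, IsPreconnected C → z ∈ C → (T ∩ C).Nonempty → (T ∩ closure W ∩ C).Nonempty := by
    intro C hC hzC ⟨t, htT, htC⟩
    by_contra hempty
    have hCW : C ∩ closure W ⊆ W := by
      rintro x ⟨hxC, hxW⟩
      exact hcl ⟨hxW, fun hxT => hempty ⟨x, ⟨hxT, hxW⟩, hxC⟩⟩
    have hCsub : C ⊆ W := hC.subset_of_closure_inter_subset hW ⟨z, hzC, hzW⟩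
      (by rwa [inter_comm])
    exact hWT (hCsub htC) htT
  obtain ⟨p, hp, -⟩ := key univ isPreconnected_univ (mem_univ z)
    (by simpa using hT.1.nonempty)
  refine ⟨p, hp.1, fun C hC hzC hne => ?_⟩
  obtain ⟨q, hq, hqC⟩ := key C hC hzC hne
  exact hsub hq hp ▸ hqC

lemma IsMaximalCyclic.subsingleton_inter [ConnectedSpace X] (hT : IsMaximalCyclic T)
    (hTc : IsClosed T) (hT' : IsMaximalCyclic T') (hne : T ≠ T') : (T ∩ T').Subsingleton := by
  obtain ⟨z, hzT', hzT⟩ : ∃ z ∈ T', z ∉ T :=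
    not_subset.1 fun h => hne (hT'.2.2 T hT.2.1 h).symm
  obtain ⟨p, hpT, hp⟩ := hT.exists_gate hTc z
  have key : ∀ x ∈ T ∩ T', x = p := by
    rintro x ⟨hxT, hxT'⟩
    have hzx : z ≠ x := by rintro rfl; exact hzT hxT
    obtain ⟨J, -, hJ, hzJ, hxJ⟩ := hT'.2.1 z hzT' x hxT' hzx
    obtain ⟨A, B, hA, hB, -, hAB⟩ := hJ.exists_isArc_isArc hzJ hxJ hzx
    have hpAB : p ∈ A ∩ B := ⟨hp A hA.isPreconnected hA.left_mem ⟨x, hxT, hA.right_mem⟩,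
      hp B hB.isPreconnected hB.left_mem ⟨x, hxT, hB.right_mem⟩⟩
    rw [hAB] at hpAB
    rcases hpAB with h | h
    · exact absurd (h ▸ hpT) hzT
    · exact h.symm
  exact fun x hx y hy => (key x hx).trans (key y hy).symm

end CyclicElements

/-! ## Admissible subcontinua -/

lemma isClosed_surfaceBoundary (X : Type*) [TopologicalSpace X] :
    IsClosed (surfaceBoundary X) := by
  refine ⟨isOpen_iff_forall_mem_open.2 fun x hx => ?_⟩
  obtain ⟨U, V, hU, hxU, hV, e⟩ := not_not.1 hx
  exact ⟨U, fun y hy => not_not.2 ⟨U, V, hU, hy, hV, e⟩, hU, hxU⟩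

namespace IsBoundaryComponentOf

variable {X : Type*} [TopologicalSpace X] {T b b' : Set X}

lemma subset (h : IsBoundaryComponentOf T b) : b ⊆ T := by
  obtain ⟨b, -, rfl⟩ := h
  exact Subtype.coe_image_subset T b

lemma isSubcontinuum (h : IsBoundaryComponentOf T b) (hT : IsCompactSurface T) :
    IsSubcontinuum b := by
  obtain ⟨_, ⟨x, hx, rfl⟩, rfl⟩ := h
  have := hT.1
  refine ⟨IsCompact.image ?_ continuous_subtype_val, IsConnected.image
    (isConnected_connectedComponentIn_iff.2 hx) _ continuous_subtype_val.continuousOn⟩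
  rw [connectedComponentIn_eq_image hx]
  exact ((isClosed_surfaceBoundary T).isClosedMap_subtype_val _
    isClosed_connectedComponent).isCompact

lemma eq_of_mem (h : IsBoundaryComponentOf T b) (h' : IsBoundaryComponentOf T b') {x : X}
    (hx : x ∈ b) (hx' : x ∈ b') : b = b' := by
  obtain ⟨_, ⟨y, -, rfl⟩, rfl⟩ := h
  obtain ⟨_, ⟨y', -, rfl⟩, rfl⟩ := h'
  obtain ⟨u, hu, rfl⟩ := hx
  obtain ⟨u', hu', huu⟩ := hx'
  obtain rfl := Subtype.ext huu
  rw [connectedComponentIn_eq hu, connectedComponentIn_eq hu']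

end IsBoundaryComponentOf

lemma isAdmissible_singleton {X : Type*} [TopologicalSpace X] (z : X) :
    IsAdmissible ({z} : Set X) :=
  ⟨⟨isCompact_singleton, isConnected_singleton⟩,
    fun _ _ => Or.inl (subsingleton_singleton.anti inter_subset_right)⟩

/-- The largest admissible subcontinuum through a point. -/
def maxAdmissible {X : Type*} [TopologicalSpace X] (z : X) : Set X :=
  closure (⋃₀ {C | IsAdmissible C ∧ z ∈ C})

/-- The points lying on a boundary component of some maximal cyclic subset. -/
def boundaryPoints (X : Type*) [TopologicalSpace X] : Set X :=
  {x | ∃ T b, IsMaximalCyclic T ∧ IsBoundaryComponentOf T b ∧ x ∈ b}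

lemma IsAdmissible.subset_maxAdmissible {X : Type*} [TopologicalSpace X] {C : Set X} {z : X}
    (hC : IsAdmissible C) (hz : z ∈ C) : C ⊆ maxAdmissible z :=
  (subset_sUnion_of_mem (show C ∈ {C | IsAdmissible C ∧ z ∈ C} from ⟨hC, hz⟩)).trans
    subset_closure

lemma mem_maxAdmissible {X : Type*} [TopologicalSpace X] (z : X) : z ∈ maxAdmissible z :=
  (isAdmissible_singleton z).subset_maxAdmissible rfl rfl

lemma IsPreBoundary.subset_sUnion_maxAdmissible {X : Type*} [TopologicalSpace X]
    (hsurf : ∀ T : Set X, IsMaximalCyclic T → IsCompactSurface T) {P : Set X}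
    (hP : IsPreBoundary P) : P ⊆ ⋃₀ (maxAdmissible '' boundaryPoints X) := by
  obtain ⟨n, C, hC, -, hbd, -, rfl⟩ := hP
  refine iUnion_subset fun i => ?_
  obtain ⟨T, b, hT, hb, hbC⟩ := hbd i
  obtain ⟨x, hx⟩ := (hb.isSubcontinuum (hsurf T hT)).2.nonempty
  exact ((hC i).subset_maxAdmissible (hbC hx)).trans
    (subset_sUnion_of_mem ⟨x, ⟨T, b, hT, hb, hx⟩, rfl⟩)

section Admissible

variable {X : Type*} [MetricSpace X] [CompactSpace X] [ConnectedSpace X]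
  [LocallyConnectedSpace X]

lemma IsBoundaryComponentOf.isAdmissible
    (hsurf : ∀ T : Set X, IsMaximalCyclic T → IsCompactSurface T) {T b : Set X}
    (hb : IsBoundaryComponentOf T b) (hT : IsMaximalCyclic T) : IsAdmissible b := by
  refine ⟨hb.isSubcontinuum (hsurf T hT), fun T' hT' => ?_⟩
  by_cases h : T' = T
  · right
    rwa [h, inter_eq_self_of_subset_right hb.subset]
  · left
    have := (hsurf T' hT').1
    exact (hT'.subsingleton_inter (isCompact_iff_compactSpace.2 this).isClosed hT h).anti
      (inter_subset_inter_right _ hb.subset)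

lemma isAdmissible_maxAdmissible
    (hsurf : ∀ T : Set X, IsMaximalCyclic T → IsCompactSurface T) (z : X) :
    IsAdmissible (maxAdmissible z) := by
  rw [maxAdmissible]
  set M := ⋃₀ {C : Set X | IsAdmissible C ∧ z ∈ C} with hM
  have hzM : z ∈ M := ⟨{z}, ⟨isAdmissible_singleton z, rfl⟩, rfl⟩
  have hMc : IsPreconnected M :=
    isPreconnected_sUnion z _ (fun C hC => hC.2) fun C hC => hC.1.1.2.isPreconnected
  refine ⟨⟨isClosed_closure.isCompact, ⟨z, subset_closure hzM⟩, hMc.closure⟩, fun T hT => ?_⟩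
  have hTc : IsClosed T := by
    have := (hsurf T hT).1
    exact (isCompact_iff_compactSpace.2 this).isClosed
  obtain ⟨p, hpT, hp⟩ := hT.exists_gate hTc z
  by_cases hne : (T ∩ M).Nonempty
  · have hTM : IsClosed (T ∩ M) ∧ ((T ∩ M).Subsingleton ∨ IsBoundaryComponentOf T (T ∩ M)) := by
      by_cases hex : ∃ C, IsAdmissible C ∧ z ∈ C ∧ IsBoundaryComponentOf T (T ∩ C)
      · obtain ⟨C, hC, hzC, hb⟩ := hex
        have hbc := hb.isSubcontinuum (hsurf T hT)
        have hpC := hp C hC.1.2.isPreconnected hzC hbc.2.nonempty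
        have heq : T ∩ M = T ∩ C := by
          refine Subset.antisymm ?_ (inter_subset_inter_right _ (subset_sUnion_of_mem ⟨hC, hzC⟩))
          rintro x ⟨hxT, C', ⟨hC', hzC'⟩, hxC'⟩
          have hpC' := hp C' hC'.1.2.isPreconnected hzC' ⟨x, hxT, hxC'⟩
          rcases hC'.2 T hT with h | h
          · rw [h ⟨hxT, hxC'⟩ ⟨hpT, hpC'⟩]
            exact ⟨hpT, hpC⟩
          · rw [hb.eq_of_mem h ⟨hpT, hpC⟩ ⟨hpT, hpC'⟩]
            exact ⟨hxT, hxC'⟩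
        rw [heq]
        exact ⟨hbc.1.isClosed, Or.inr hb⟩
      · have hs : (T ∩ M).Subsingleton := by
          refine subsingleton_singleton.anti (t := {p}) ?_
          rintro x ⟨hxT, C, ⟨hC, hzC⟩, hxC⟩
          have hpC := hp C hC.1.2.isPreconnected hzC ⟨x, hxT, hxC⟩
          rcases hC.2 T hT with h | h
          · exact h ⟨hxT, hxC⟩ ⟨hpT, hpC⟩
          · exact absurd ⟨C, hC, hzC, h⟩ hex
        exact ⟨hs.finite.isClosed, Or.inl hs⟩
    have heq : T ∩ closure M = T ∩ M := by
      refine Subset.antisymm ?_ (inter_subset_inter_right _ subset_closure)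
      rintro x ⟨hxT, hxM⟩
      by_contra hx
      obtain ⟨V, hVsub, hV, hVc, hxV⟩ := exists_isOpen_isConnected_subset hTM.1.isOpen_compl hx
      obtain ⟨y, hyV, hyM⟩ := mem_closure_iff.1 hxM V hV hxV
      obtain ⟨g, hgT, hg⟩ := hT.exists_gate hTc y
      exact hVsub (hg V hVc.isPreconnected hyV ⟨x, hxT, hxV⟩) ⟨hgT, hg M hMc hyM hne⟩
    rw [heq]
    exact hTM.2
  · left
    have key : ∀ V, IsOpen V → IsConnected V → ∀ x ∈ V, x ∈ T ∩ closure M → p ∈ V := by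
      rintro V hV hVc x hxV ⟨hxT, hxM⟩
      obtain ⟨y, hyV, hyM⟩ := mem_closure_iff.1 hxM V hV hxV
      rcases hp (V ∪ M) (hVc.isPreconnected.union y hyV hyM hMc) (Or.inr hzM)
        ⟨x, hxT, Or.inl hxV⟩ with h | h
      · exact h
      · exact absurd ⟨p, hpT, h⟩ hne
    intro x hx x' hx'
    by_contra hxx
    obtain ⟨U, U', hU, hU', hxU, hxU', hd⟩ := t2_separation hxx
    obtain ⟨V, hVU, hV, hVc, hxV⟩ := exists_isOpen_isConnected_subset hU hxU
    obtain ⟨V', hVU', hV', hVc', hxV'⟩ := exists_isOpen_isConnected_subset hU' hxU'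
    exact Set.disjoint_left.1 hd (hVU (key V hV hVc x hxV hx)) (hVU' (key V' hV' hVc' x' hxV' hx'))

lemma maxAdmissible_eq_of_mem
    (hsurf : ∀ T : Set X, IsMaximalCyclic T → IsCompactSurface T) {w z : X}
    (h : w ∈ maxAdmissible z) : maxAdmissible w = maxAdmissible z := by
  have hsub := (isAdmissible_maxAdmissible hsurf z).subset_maxAdmissible h
  exact Subset.antisymm ((isAdmissible_maxAdmissible hsurf w).subset_maxAdmissible
    (hsub (mem_maxAdmissible z))) hsub

lemma card_maxAdmissible_le (hsurf : ∀ T : Set X, IsMaximalCyclic T → IsCompactSurface T)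
    {n : ℕ} {C : Fin n → Set X} (hC : ∀ i, IsAdmissible (C i))
    (hcov : ∀ T b : Set X, IsMaximalCyclic T → IsBoundaryComponentOf T b → b ⊆ ⋃ i, C i) :
    Finite (maxAdmissible '' boundaryPoints X) ∧
      Nat.card (maxAdmissible '' boundaryPoints X) ≤ n := by
  have h : ∀ K : maxAdmissible '' boundaryPoints X, ∃ i, ∃ x ∈ C i, maxAdmissible x = K := by
    rintro ⟨_, x, ⟨T, b, hT, hb, hx⟩, rfl⟩
    obtain ⟨i, hi⟩ := mem_iUnion.1 (hcov T b hT hb hx)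
    exact ⟨i, x, hi, rfl⟩
  choose i x hx hK using h
  have hinj : Function.Injective i := by
    intro K L hKL
    refine Subtype.ext ((hK K).symm.trans (Eq.trans ?_ (hK L)))
    exact maxAdmissible_eq_of_mem hsurf
      ((hC (i L)).subset_maxAdmissible (hx L) (hKL ▸ hx K))
  exact ⟨Finite.of_injective i hinj, by simpa using Nat.card_le_card_of_injective i hinj⟩

lemma isPreBoundaryOfSize_sUnion_maxAdmissible
    (hsurf : ∀ T : Set X, IsMaximalCyclic T → IsCompactSurface T)
    (hfin : Finite (maxAdmissible '' boundaryPoints X)) :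
    IsPreBoundaryOfSize (Nat.card (maxAdmissible '' boundaryPoints X))
      (⋃₀ (maxAdmissible '' boundaryPoints X)) := by
  let e := (Finite.equivFin (maxAdmissible '' boundaryPoints X)).symm
  have hU : ⋃₀ (maxAdmissible '' boundaryPoints X) = ⋃ i, (e i : Set X) := by
    rw [sUnion_eq_iUnion]
    exact (e.surjective.iUnion_comp _).symm
  refine ⟨fun i => e i, fun i => ?_, fun i j hij => Set.disjoint_left.2 fun x hi hj => hij ?_,
    fun i => ?_, fun T b hT hb x hx => ?_, hU⟩
  · obtain ⟨y, -, hy⟩ := (e i).2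
    beta_reduce
    rw [← hy]
    exact isAdmissible_maxAdmissible hsurf y
  · obtain ⟨y, -, hy⟩ := (e i).2
    obtain ⟨y', -, hy'⟩ := (e j).2
    beta_reduce at hi hj
    rw [← hy] at hi
    rw [← hy'] at hj
    refine e.injective (Subtype.ext ?_)
    rw [← hy, ← hy', ← maxAdmissible_eq_of_mem hsurf hi, maxAdmissible_eq_of_mem hsurf hj]
  · obtain ⟨y, ⟨T, b, hT, hb, hyb⟩, hy⟩ := (e i).2
    beta_reduce
    rw [← hy]
    exact ⟨T, b, hT, hb, (hb.isAdmissible hsurf hT).subset_maxAdmissible hyb⟩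
  · rw [← hU]
    exact ⟨_, ⟨x, ⟨T, b, hT, hb, hx⟩, rfl⟩, mem_maxAdmissible x⟩

end Admissible

/-! ## STATEMENT 11 -/

theorem stmt11 (X : Type) [MetricSpace X] (hX : IsGeneralizedCactoid X) :
    IsMinimalPreBoundary (cactoidBoundary X) ∧
    (∀ P : Set X, IsPreBoundary P → P ⊆ cactoidBoundary X) ∧
    (∀ Q : Set X, IsMinimalPreBoundary Q →
      (∀ P : Set X, IsPreBoundary P → P ⊆ Q) → Q = cactoidBoundary X) := by
  obtain ⟨⟨_, _, _⟩, hsurf, -, n, C, hC, -, hcov⟩ := hX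
  have hmin : IsMinimalPreBoundary (⋃₀ (maxAdmissible '' boundaryPoints X)) := by
    refine ⟨_, isPreBoundaryOfSize_sUnion_maxAdmissible hsurf
      (card_maxAdmissible_le hsurf hC hcov).1, ?_⟩
    rintro m _ ⟨D, hD, -, -, hDcov, -⟩
    exact (card_maxAdmissible_le hsurf hD hDcov).2
  have hpre : ∀ Q : Set X, IsMinimalPreBoundary Q → IsPreBoundary Q :=
    fun Q ⟨m, hm, _⟩ => ⟨m, hm⟩
  have heq : cactoidBoundary X = ⋃₀ (maxAdmissible '' boundaryPoints X) :=
    Subset.antisymm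
      (sUnion_subset fun P hP => (hpre P hP).subset_sUnion_maxAdmissible hsurf)
      (subset_sUnion_of_mem hmin)
  have hmax : ∀ P : Set X, IsPreBoundary P → P ⊆ cactoidBoundary X :=
    fun P hP => heq ▸ hP.subset_sUnion_maxAdmissible hsurf
  exact ⟨heq ▸ hmin, hmax, fun Q hQ hQ' => Subset.antisymm (hmax Q (hpre Q hQ))
    (sUnion_subset fun P hP => hQ' P (hpre P hP))⟩
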